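/- arXiv:2603.05709 — 15 statements merged into one kernel-verified Lean document; each statement's English description precedes it below -/
import Mathlib

section
/- Let n ≥ r ≥ 1 and let A ∈ ℂ^{n×n} be Hermitian positive-semidefinite. Suppose Â_part = F·diag(D₁₁,0)·F* where F is the block matrix [[L₁₁, 0],[L₂₁, I]] with L₁₁ ∈ ℂ^{r×r} unit lower triangular, L₂₁ ∈ ℂ^{(n−r)×r}, and D₁₁ ∈ ℝ^{r×r} a nonnegative diagonal matrix, and suppose the first r rows of Â_part coincide with the first r rows of A. Let R = A − Â_part. Suppose Ĉ₂₂ ∈ ℂ^{(n−r)×(n−r)} is unit lower triangular, Q_i ⊆ {r+1,…,i−1} for i = r+1,…,n are index sets with Ĉ₂₂(i−r, j−r) = 0 whenever j ∉ Q_i ∪ {i}, and D̂₂₂ ∈ ℝ^{(n−r)×(n−r)} is a nonnegative diagonal matrix such that, writing C_res = [[I, 0],[0, Ĉ₂₂]], for every i ∈ {r+1,…,n} one has (C_res·R)(i,j) = 0 for all j ∈ Q_i and (C_res·R)(i,i) = D̂₂₂(i−r,i−r). Define Ĉ = [[L₁₁⁻¹, 0],[−Ĉ₂₂·L₂₁·L₁₁⁻¹,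 Ĉ₂₂]] and D̂ = diag(D₁₁, D̂₂₂), and set S_i = ({1,…,r} ∪ Q_i) ∩ {1,…,i−1}. Then: (i) Ĉ is unit lower triangular and Ĉ(i,j) = 0 whenever j ∉ S_i ∪ {i}; (ii) for every i ∈ {1,…,n}, (Ĉ·A)(i,j) = 0 for all j ∈ S_i and (Ĉ·A)(i,i) = D̂(i,i); and (iii) Â_part + C_res⁻¹·diag(0, D̂₂₂)·C_res⁻* = Ĉ⁻¹·D̂·Ĉ⁻*. -/
open Matrix
open scoped ComplexOrder

/-- A unit lower triangular complex matrix: ones on the diagonal,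
zeros strictly above the diagonal. -/
def UnitLowerTri {n : ℕ} (C : Matrix (Fin n) (Fin n) ℂ) : Prop :=
  (∀ i, C i i = 1) ∧ ∀ i j : Fin n, i < j → C i j = 0

theorem ult_det {n : ℕ} {C : Matrix (Fin n) (Fin n) ℂ} (h : UnitLowerTri C) : C.det = 1 := by
  have hb : C.BlockTriangular OrderDual.toDual := fun i j hij => h.2 i j hij
  rw [Matrix.det_of_lowerTriangular C hb]
  simp [h.1]

theorem lt_diag {n : ℕ} {B C : Matrix (Fin n) (Fin n) ℂ}
    (hB : ∀ i j : Fin n, i < j → B i j = 0) (hC : ∀ i j : Fin n, i < j → C i j = 0) (i : Fin n) :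
    (B * C) i i = B i i * C i i := by
  rw [Matrix.mul_apply]
  apply Finset.sum_eq_single i
  · intro k _ hk
    rcases lt_or_gt_of_ne hk with h | h
    · rw [hC k i h, mul_zero]
    · rw [hB i k h, zero_mul]
  · simp

theorem ult_mul {n : ℕ} {B C : Matrix (Fin n) (Fin n) ℂ} (hB : UnitLowerTri B)
    (hC : UnitLowerTri C) : UnitLowerTri (B * C) := by
  refine ⟨fun i => ?_, fun i j hij => ?_⟩
  · rw [lt_diag hB.2 hC.2, hB.1, hC.1, mul_one]
  · rw [Matrix.mul_apply]
    apply Finset.sum_eq_zero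
    intro k _
    rcases lt_or_ge i k with h | h
    · rw [hB.2 i k h, zero_mul]
    · rw [hC.2 k j (lt_of_le_of_lt h hij), mul_zero]

theorem ult_inv {n : ℕ} {C : Matrix (Fin n) (Fin n) ℂ} (h : UnitLowerTri C) :
    UnitLowerTri C⁻¹ := by
  have hu : IsUnit C.det := by rw [ult_det h]; exact isUnit_one
  letI := Matrix.invertibleOfIsUnitDet C hu
  have hb : C.BlockTriangular OrderDual.toDual := fun i j hij => h.2 i j hij
  have hb2 := Matrix.blockTriangular_inv_of_blockTriangular hb
  have h2 : ∀ i j : Fin n, i < j → C⁻¹ i j = 0 := fun i j hij => hb2 hij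
  refine ⟨fun i => ?_, h2⟩
  have := lt_diag h.2 h2 i
  rw [Matrix.mul_nonsing_inv C hu, h.1] at this
  simpa using this.symm

/-- **Partial Cholesky + Vecchia = Vecchia.**
Given a rank-`r` partial pivoted Cholesky approximation
`Apart = F ⬝ diag(d₁,0) ⬝ Fᴴ` (with `F = [[L₁₁,0],[L₂₁,I]]` unit lower
triangular whose last `n-r` columns agree with the identity off the diagonal)
whose first `r` rows match those of `A`, and a Vecchia approximation of the
residual `R = A - Apart` with inverse Cholesky factor
`Cres = [[I,0],[0,Ĉ₂₂]]` (sparsity sets `Q i ⊆ {r,…,i-1}`) and diagonal `d₂`,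
the matrix `Chat = Cres * F⁻¹` (which equals the block matrix
`[[L₁₁⁻¹,0],[−Ĉ₂₂L₂₁L₁₁⁻¹, Ĉ₂₂]]`) together with `Dhat = diag(d₁, d₂)` gives
a Vecchia approximation of `A` with augmented sparsity pattern
`S i = ({0,…,r-1} ∪ Q i) ∩ {0,…,i-1}`, and the sum of the two approximations
equals `Chat⁻¹ * Dhat * Chat⁻ᴴ`. -/
theorem partial_cholesky_plus_vecchia_eq_vecchia
    (n r : ℕ) (hr1 : 1 ≤ r) (hrn : r ≤ n)
    (A : Matrix (Fin n) (Fin n) ℂ) (hA : A.PosSemidef)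
    -- `F = [[L₁₁, 0],[L₂₁, I]]` with `L₁₁` unit lower triangular
    (F : Matrix (Fin n) (Fin n) ℂ) (hF : UnitLowerTri F)
    (hFblock : ∀ i j : Fin n, r ≤ (j : ℕ) → i ≠ j → F i j = 0)
    -- `diag(D₁₁, 0)` with `D₁₁` a nonnegative diagonal `r × r` block
    (d1 : Fin n → ℝ) (hd1 : ∀ i, 0 ≤ d1 i)
    (hd1r : ∀ i : Fin n, r ≤ (i : ℕ) → d1 i = 0)
    (Apart : Matrix (Fin n) (Fin n) ℂ)
    (hApart : Apart = F * Matrix.diagonal (fun i => (d1 i : ℂ)) * Fᴴ)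
    -- the first `r` rows of `Apart` coincide with the first `r` rows of `A`
    (hrows : ∀ i j : Fin n, (i : ℕ) < r → Apart i j = A i j)
    (R : Matrix (Fin n) (Fin n) ℂ) (hR : R = A - Apart)
    -- `Cres = [[I, 0],[0, Ĉ₂₂]]` with `Ĉ₂₂` unit lower triangular
    (Cres : Matrix (Fin n) (Fin n) ℂ) (hCres : UnitLowerTri Cres)
    (hCresblock : ∀ i j : Fin n, (j : ℕ) < r → i ≠ j → Cres i j = 0)
    -- sparsity sets `Q i ⊆ {r, …, i-1}` governing `Ĉ₂₂`
    (Q : Fin n → Finset (Fin n))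
    (hQ : ∀ i : Fin n, ∀ j ∈ Q i, r ≤ (j : ℕ) ∧ j < i)
    (hCresSparse : ∀ i j : Fin n, i ≠ j → j ∉ Q i → Cres i j = 0)
    -- `diag(0, D̂₂₂)` with `D̂₂₂` a nonnegative diagonal `(n-r) × (n-r)` block
    (d2 : Fin n → ℝ) (hd2 : ∀ i, 0 ≤ d2 i)
    (hd2r : ∀ i : Fin n, (i : ℕ) < r → d2 i = 0)
    -- the Vecchia conditions for the residual `R`
    (hVecchia : ∀ i : Fin n, r ≤ (i : ℕ) →
      (∀ j ∈ Q i, (Cres * R) i j = 0) ∧ (Cres * R) i i = (d2 i : ℂ))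
    -- `Chat = [[L₁₁⁻¹, 0],[−Ĉ₂₂ L₂₁ L₁₁⁻¹, Ĉ₂₂]] = Cres * F⁻¹`
    (Chat : Matrix (Fin n) (Fin n) ℂ) (hChat : Chat = Cres * F⁻¹)
    -- `Dhat = diag(D₁₁, D̂₂₂)`
    (Dhat : Matrix (Fin n) (Fin n) ℂ)
    (hDhat : Dhat =
      Matrix.diagonal (fun i : Fin n => if (i : ℕ) < r then (d1 i : ℂ) else (d2 i : ℂ)))
    -- the augmented sparsity pattern `S i = ({0,…,r-1} ∪ Q i) ∩ {0,…,i-1}`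
    (S : Fin n → Set (Fin n))
    (hS : ∀ i : Fin n, S i = {j : Fin n | ((j : ℕ) < r ∨ j ∈ Q i) ∧ j < i}) :
    -- (i) `Chat` is unit lower triangular with sparsity pattern `S`
    (UnitLowerTri Chat ∧ ∀ i j : Fin n, j ∉ S i → i ≠ j → Chat i j = 0) ∧
    -- (ii) `Chat, Dhat` satisfy the Vecchia conditions for `A`
    (∀ i : Fin n, (∀ j ∈ S i, (Chat * A) i j = 0) ∧ (Chat * A) i i = Dhat i i) ∧
    -- (iii) partial Cholesky + Vecchia residual = Vecchia with pattern `S`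
    Apart + Cres⁻¹ * Matrix.diagonal (fun i => (d2 i : ℂ)) * (Cres⁻¹)ᴴ
      = Chat⁻¹ * Dhat * (Chat⁻¹)ᴴ := by
  have hFu : IsUnit F.det := by rw [ult_det hF]; exact isUnit_one
  have hCu : IsUnit Cres.det := by rw [ult_det hCres]; exact isUnit_one
  have hFi := Matrix.nonsing_inv_mul F hFu
  have hFi' := Matrix.mul_nonsing_inv F hFu
  have hCi := Matrix.nonsing_inv_mul Cres hCu
  have hRow : ∀ i j : Fin n, (i : ℕ) < r → i ≠ j → Cres i j = 0 := by
    intro i j hi hij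
    apply hCresSparse i j hij
    intro hj
    obtain ⟨h1, h2⟩ := hQ i j hj
    have : (j : ℕ) < i := h2
    omega
  set D1 : Matrix (Fin n) (Fin n) ℂ := Matrix.diagonal (fun i => (d1 i : ℂ)) with hD1
  set D2 : Matrix (Fin n) (Fin n) ℂ := Matrix.diagonal (fun i => (d2 i : ℂ)) with hD2
  -- the projection onto the first `r` coordinates
  obtain ⟨P, hP⟩ : ∃ P : Matrix (Fin n) (Fin n) ℂ,
    P = Matrix.diagonal (fun i : Fin n => if (i : ℕ) < r then (1 : ℂ) else 0) := ⟨_, rfl⟩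
  have hCP : Cres * P = P := by
    ext i j
    rw [hP, Matrix.mul_diagonal, Matrix.diagonal_apply]
    by_cases hj : (j : ℕ) < r
    · by_cases hij : i = j
      · subst hij; simp [hCres.1, hj]
      · simp [hCresblock i j hj hij, hij]
    · by_cases hij : i = j
      · subst hij; simp [hj]
      · simp [hj, hij]
  have hPC : P * Cres = P := by
    ext i j
    rw [hP, Matrix.diagonal_mul, Matrix.diagonal_apply]
    by_cases hi : (i : ℕ) < r
    · by_cases hij : i = j
      · subst hij; simp [hCres.1, hi]
      · simp [hRow i j hi hij, hij]
    · simp [hi]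
  have hFP : F * (1 - P) = 1 - P := by
    have : (1 - P) = Matrix.diagonal (fun i : Fin n => if (i : ℕ) < r then (0 : ℂ) else 1) := by
      rw [hP, ← Matrix.diagonal_one, Matrix.diagonal_sub]
      congr 1; ext i; split_ifs <;> simp
    rw [this]
    ext i j
    rw [Matrix.mul_diagonal, Matrix.diagonal_apply]
    by_cases hj : (j : ℕ) < r
    · by_cases hij : i = j
      · subst hij; simp [hj]
      · simp [hj, hij]
    · by_cases hij : i = j
      · subst hij; simp [hF.1]
      · simp [hFblock i j (not_lt.mp hj) hij, hij]
  have hPD1 : P * D1 = D1 := by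
    rw [hP, hD1, Matrix.diagonal_mul_diagonal]
    congr 1; ext i
    split_ifs with h
    · simp
    · simp [hd1r i (not_lt.mp h)]
  have hPD2 : P * D2 = 0 := by
    rw [hP, hD2, Matrix.diagonal_mul_diagonal, ← Matrix.diagonal_zero]
    congr 1; ext i
    split_ifs with h
    · simp [hd2r i h]
    · simp
  have hDsum : Dhat = D1 + D2 := by
    rw [hDhat, hD1, hD2, Matrix.diagonal_add]
    congr 1; ext i
    split_ifs with h
    · simp [hd2r i h]
    · simp [hd1r i (not_lt.mp h)]
  have hGP : F⁻¹ * (1 - P) = 1 - P := by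
    calc F⁻¹ * (1 - P) = F⁻¹ * (F * (1 - P)) := by rw [hFP]
      _ = 1 - P := by rw [← mul_assoc, hFi, one_mul]
  have hFX : ∀ X : Matrix (Fin n) (Fin n) ℂ, P * X = 0 → F * X = X := by
    intro X hX
    have h1 : (1 - P) * X = X := by rw [sub_mul, hX, one_mul, sub_zero]
    rw [← h1, ← mul_assoc, hFP]
  have hGX : ∀ X : Matrix (Fin n) (Fin n) ℂ, P * X = 0 → F⁻¹ * X = X := by
    intro X hX
    have h1 : (1 - P) * X = X := by rw [sub_mul, hX, one_mul, sub_zero]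
    rw [← h1, ← mul_assoc, hGP]
  have hCD1 : Cres * D1 = D1 := by rw [← hPD1, ← mul_assoc, hCP]
  have hCiD1 : Cres⁻¹ * D1 = D1 := by
    calc Cres⁻¹ * D1 = Cres⁻¹ * (Cres * D1) := by rw [hCD1]
      _ = D1 := by rw [← mul_assoc, hCi, one_mul]
  have hPCi : P * Cres⁻¹ = P := by
    calc P * Cres⁻¹ = P * Cres * Cres⁻¹ := by rw [hPC]
      _ = P := by rw [mul_assoc, Matrix.mul_nonsing_inv Cres hCu, mul_one]
  have hD1H : D1ᴴ = D1 := by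
    rw [hD1, Matrix.diagonal_conjTranspose]; congr 1; ext i; simp
  have hD2H : D2ᴴ = D2 := by
    rw [hD2, Matrix.diagonal_conjTranspose]; congr 1; ext i; simp
  have hR0 : ∀ i j : Fin n, (i : ℕ) < r → R i j = 0 := by
    intro i j hi
    rw [hR, Matrix.sub_apply, hrows i j hi, sub_self]
  have hRH : Rᴴ = R := by
    rw [hR, hApart, Matrix.conjTranspose_sub, hA.1.eq]
    simp only [Matrix.conjTranspose_mul, Matrix.conjTranspose_conjTranspose, hD1H, mul_assoc]
  have hR0' : ∀ i j : Fin n, (j : ℕ) < r → R i j = 0 := by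
    intro i j hj
    rw [← hRH, Matrix.conjTranspose_apply, hR0 j i hj, star_zero]
  have hPR : P * R = 0 := by
    ext i j
    rw [hP, Matrix.diagonal_mul]
    by_cases hi : (i : ℕ) < r
    · simp [hR0 i j hi]
    · simp [hi]
  have hChatU : UnitLowerTri Chat := by
    rw [hChat]; exact ult_mul hCres (ult_inv hF)
  have hCA : Chat * A = Cres * R + D1 * Fᴴ := by
    have hAe : A = R + F * D1 * Fᴴ := by rw [hR, hApart]; abel
    rw [hAe, hChat, mul_add]
    congr 1
    · rw [mul_assoc, hGX R hPR]
    · calc Cres * F⁻¹ * (F * D1 * Fᴴ) = Cres * (F⁻¹ * F) * D1 * Fᴴ := by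
            simp only [mul_assoc]
        _ = D1 * Fᴴ := by rw [hFi, mul_one, hCD1]
  have hCAe : ∀ i j, (Chat * A) i j = (Cres * R) i j + d1 i * star (F j i) := by
    intro i j
    rw [hCA, Matrix.add_apply, hD1, Matrix.diagonal_mul, Matrix.conjTranspose_apply]
  have hCRtop : ∀ i j : Fin n, (i : ℕ) < r → (Cres * R) i j = 0 := by
    intro i j hi
    rw [Matrix.mul_apply]
    apply Finset.sum_eq_zero
    intro k _
    by_cases hik : i = k
    · rw [← hik, hR0 i j hi, mul_zero]
    · rw [hRow i k hi hik, zero_mul]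
  refine ⟨⟨hChatU, ?_⟩, ?_, ?_⟩
  · intro i j hj hij
    rcases lt_or_gt_of_ne hij with h | h
    · exact hChatU.2 i j h
    · rw [hS] at hj
      simp only [Set.mem_setOf_eq, not_and, not_or] at hj
      have hj1 : ¬ (j : ℕ) < r := fun hh => hj (Or.inl hh) h
      have hj2 : j ∉ Q i := fun hh => hj (Or.inr hh) h
      have e : Chat * (1 - P) = Cres * (1 - P) := by rw [hChat, mul_assoc, hGP]
      have e2 := congrFun (congrFun e i) j
      rw [mul_sub, mul_sub, mul_one, mul_one, Matrix.sub_apply, Matrix.sub_apply, hP,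
        Matrix.mul_diagonal, Matrix.mul_diagonal, if_neg hj1] at e2
      simp only [mul_zero, sub_zero] at e2
      rw [e2, hCresSparse i j hij hj2]
  · intro i
    by_cases hi : (i : ℕ) < r
    · refine ⟨fun j hj => ?_, ?_⟩
      · rw [hS] at hj
        rw [hCAe, hCRtop i j hi, hF.2 j i hj.2]
        simp
      · rw [hCAe, hCRtop i i hi, hF.1, hDhat, Matrix.diagonal_apply_eq, if_pos hi]
        simp
    · have hi' := not_lt.mp hi
      obtain ⟨v1, v2⟩ := hVecchia i hi'
      refine ⟨fun j hj => ?_, ?_⟩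
      · rw [hS] at hj
        rw [hCAe, hd1r i hi']
        rcases hj.1 with h | h
        · have : (Cres * R) i j = 0 := by
            rw [Matrix.mul_apply]
            apply Finset.sum_eq_zero
            intro k _
            rw [hR0' k j h, mul_zero]
          simp [this]
        · simp [v1 j h]
      · rw [hCAe, hd1r i hi', v2, hDhat, Matrix.diagonal_apply_eq, if_neg hi]
        simp
  · have hChi : Chat⁻¹ = F * Cres⁻¹ := by
      rw [hChat, Matrix.mul_inv_rev, Matrix.nonsing_inv_nonsing_inv F hFu]
    have k1 : Chat⁻¹ * D1 = F * D1 := by rw [hChi, mul_assoc, hCiD1]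
    have k2 : Chat⁻¹ * D2 = Cres⁻¹ * D2 := by
      rw [hChi, mul_assoc]
      apply hFX
      rw [← mul_assoc, hPCi, hPD2]
    have k1' : D1 * (Chat⁻¹)ᴴ = D1 * Fᴴ := by
      have := congrArg Matrix.conjTranspose k1
      rwa [Matrix.conjTranspose_mul, Matrix.conjTranspose_mul, hD1H] at this
    have k2' : D2 * (Chat⁻¹)ᴴ = D2 * (Cres⁻¹)ᴴ := by
      have := congrArg Matrix.conjTranspose k2
      rwa [Matrix.conjTranspose_mul, Matrix.conjTranspose_mul, hD2H] at this
    rw [hDsum, mul_add, add_mul, hApart, k1, k2, mul_assoc F, mul_assoc F, k1',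
      mul_assoc Cres⁻¹, mul_assoc Cres⁻¹, k2']
end

section
/- Let A ∈ ℂ^{n×n} be Hermitian positive-definite and let S_i ⊆ {1,…,i−1} for i = 1,…,n be a sparsity pattern. Let Ĉ_V be the unique unit lower triangular matrix with Ĉ_V(i,j) = 0 for j ∉ S_i ∪ {i} satisfying Ĉ_V(i,S_i)·A(S_i,S_i) + A(i,S_i) = 0 for every i, and let D̂_V be the diagonal matrix with D̂_V(i,i) = (Ĉ_V·A·Ĉ_V*)(i,i); set Â_V = Ĉ_V⁻¹·D̂_V·Ĉ_V⁻*. Then for every unit lower triangular Ĉ with Ĉ(i,j) = 0 for all j ∉ S_i ∪ {i} and every diagonal matrix D̂ with strictly positive diagonal entries, the matrix Â = Ĉ⁻¹·D̂·Ĉ⁻* satisfies κ_Kap(Â) ≥ κ_Kap(Â_V), where κ_Kap(Â) = ((1/n)·tr(A·Â⁻¹))ⁿ / det(A·Â⁻¹). -/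
open Matrix
open scoped ComplexOrder

/-- The Kaporin condition number `((1/n)·tr(A·Â⁻¹))ⁿ / det(A·Â⁻¹)` of an
approximation `Ahat` of `A` (a real number when `A`, `Ahat` are Hermitian
positive-definite). -/
noncomputable def kaporin {n : ℕ} (A Ahat : Matrix (Fin n) (Fin n) ℂ) : ℝ :=
  ((1 / (n : ℝ)) * ((A * Ahat⁻¹).trace).re) ^ n / ((A * Ahat⁻¹).det).re

theorem UnitLowerTri.det_one {n : ℕ} {C : Matrix (Fin n) (Fin n) ℂ} (hC : UnitLowerTri C) :
    C.det = 1 := by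
  rw [Matrix.det_of_lowerTriangular C (fun i j h => hC.2 i j (by simpa using h))]
  simp [hC.1]

theorem kaporin_formula {n : ℕ} (A C : Matrix (Fin n) (Fin n) ℂ) (hC : UnitLowerTri C)
    (d : Fin n → ℝ) (hd : ∀ i, 0 < d i) :
    kaporin A (C⁻¹ * Matrix.diagonal (fun i => (d i : ℂ)) * (C⁻¹)ᴴ) =
      ((1 / (n : ℝ)) * ∑ i, ((C * A * Cᴴ) i i).re / d i) ^ n / (A.det.re * ∏ i, (d i)⁻¹) := by
  have hdet := hC.det_one
  have hu : IsUnit C.det := by rw [hdet]; exact isUnit_one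
  have hinv : (C⁻¹ * Matrix.diagonal (fun i => (d i : ℂ)) * (C⁻¹)ᴴ)⁻¹ =
      Cᴴ * Matrix.diagonal (fun i => (((d i)⁻¹ : ℝ) : ℂ)) * C := by
    have hD : (Matrix.diagonal (fun i => (d i : ℂ)))⁻¹ =
        Matrix.diagonal (fun i => (((d i)⁻¹ : ℝ) : ℂ)) := by
      apply Matrix.inv_eq_right_inv
      rw [Matrix.diagonal_mul_diagonal, ← Matrix.diagonal_one]
      congr 1
      funext i
      have : (d i : ℂ) ≠ 0 := by exact_mod_cast (hd i).ne'
      push_cast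
      field_simp
    rw [Matrix.mul_inv_rev, Matrix.mul_inv_rev, hD, ← Matrix.conjTranspose_nonsing_inv,
      Matrix.nonsing_inv_nonsing_inv _ hu, Matrix.mul_assoc]
  have htr : (A * (Cᴴ * Matrix.diagonal (fun i => (((d i)⁻¹ : ℝ) : ℂ)) * C)).trace.re =
      ∑ i, ((C * A * Cᴴ) i i).re / d i := by
    rw [← Matrix.mul_assoc, Matrix.trace_mul_comm, ← Matrix.mul_assoc, ← Matrix.mul_assoc,
      Matrix.trace, Complex.re_sum]
    refine Finset.sum_congr rfl fun i _ => ?_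
    rw [Matrix.diag_apply, Matrix.mul_diagonal, Complex.re_mul_ofReal, div_eq_mul_inv]
  have hdt : (A * (Cᴴ * Matrix.diagonal (fun i => (((d i)⁻¹ : ℝ) : ℂ)) * C)).det.re =
      A.det.re * ∏ i, (d i)⁻¹ := by
    rw [Matrix.det_mul, Matrix.det_mul, Matrix.det_mul, Matrix.det_conjTranspose, hdet,
      Matrix.det_diagonal, ← Complex.ofReal_prod]
    simp [-Complex.ofReal_prod, -Finset.prod_inv_distrib]
  rw [kaporin, hinv, htr, hdt]

theorem row_pos {n : ℕ} (A C : Matrix (Fin n) (Fin n) ℂ) (hA : A.PosDef)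
    (hC : UnitLowerTri C) (i : Fin n) : 0 < (C * A * Cᴴ) i i := by
  have hu : IsUnit C := by
    rw [Matrix.isUnit_iff_isUnit_det, hC.det_one]; exact isUnit_one
  have h : (C * A * Cᴴ).PosDef := by
    apply hA.mul_mul_conjTranspose_same
    exact Matrix.vecMul_injective_of_isUnit hu
  exact h.diag_pos

theorem row_min {n : ℕ} (A C CV : Matrix (Fin n) (Fin n) ℂ) (hA : A.PosDef)
    (S : Fin n → Finset (Fin n)) (hS : ∀ i : Fin n, ∀ j ∈ S i, j < i)
    (hCV : UnitLowerTri CV)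
    (hCVsparse : ∀ i j : Fin n, i ≠ j → j ∉ S i → CV i j = 0)
    (hCVeq : ∀ i : Fin n, ∀ j ∈ S i, (∑ k ∈ S i, CV i k * A k j) + A i j = 0)
    (hC : UnitLowerTri C)
    (hCsparse : ∀ i j : Fin n, i ≠ j → j ∉ S i → C i j = 0) (i : Fin n) :
    (CV * A * CVᴴ) i i ≤ (C * A * Cᴴ) i i := by
  have hz : ∀ j ∈ S i, (CV * A) i j = 0 := by
    intro j hj
    have hi : i ∉ S i := fun h => lt_irrefl _ (hS i i h)
    rw [← hCVeq i j hj, Matrix.mul_apply,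
      ← Finset.sum_subset (Finset.subset_univ (insert i (S i))), Finset.sum_insert hi,
      hCV.1 i, one_mul, add_comm]
    intro k _ hk
    rw [Finset.mem_insert, not_or] at hk
    rw [hCVsparse i k (Ne.symm hk.1) hk.2, zero_mul]
  have hE : ∀ j, j ∉ S i → (C - CV) i j = 0 := by
    intro j hj
    rw [Matrix.sub_apply]
    by_cases h : i = j
    · subst h; rw [hC.1, hCV.1, sub_self]
    · rw [hCsparse i j h hj, hCVsparse i j h hj, sub_self]
  have hx : (CV * A * (C - CV)ᴴ) i i = 0 := by
    rw [Matrix.mul_apply]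
    refine Finset.sum_eq_zero fun j _ => ?_
    by_cases hj : j ∈ S i
    · rw [hz j hj, zero_mul]
    · rw [Matrix.conjTranspose_apply, hE j hj, star_zero, mul_zero]
  have hy : ((C - CV) * A * CVᴴ) i i = 0 := by
    have : ((C - CV) * A * CVᴴ) = (CV * A * (C - CV)ᴴ)ᴴ := by
      rw [Matrix.conjTranspose_mul, Matrix.conjTranspose_mul, Matrix.conjTranspose_conjTranspose,
        hA.isHermitian.eq, Matrix.mul_assoc]
    rw [this, Matrix.conjTranspose_apply, hx, star_zero]
  have hp : 0 ≤ ((C - CV) * A * (C - CV)ᴴ) i i :=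
    (hA.posSemidef.mul_mul_conjTranspose_same (C - CV)).diag_nonneg
  have hdec : C * A * Cᴴ = CV * A * CVᴴ + CV * A * (C - CV)ᴴ + (C - CV) * A * CVᴴ
      + (C - CV) * A * (C - CV)ᴴ := by
    rw [Matrix.conjTranspose_sub]
    noncomm_ring
  rw [hdec, Matrix.add_apply, Matrix.add_apply, Matrix.add_apply, hx, hy, add_zero, add_zero]
  exact le_add_of_nonneg_right hp

theorem amgm {n : ℕ} (x : Fin n → ℝ) (hx : ∀ i, 0 ≤ x i) :
    ∏ i, x i ≤ ((1 / (n : ℝ)) * ∑ i, x i) ^ n := by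
  rcases Nat.eq_zero_or_pos n with h | h
  · subst h; simp
  have hn : (0 : ℝ) < n := by exact_mod_cast h
  have h1 := Real.geom_mean_le_arith_mean Finset.univ (fun _ => (1 : ℝ)) x
    (fun _ _ => zero_le_one) (by simpa using h) (fun i _ => hx i)
  simp only [Real.rpow_one, Finset.sum_const, Finset.card_univ, Fintype.card_fin, nsmul_eq_mul,
    mul_one, one_mul] at h1
  have hP : 0 ≤ ∏ i, x i := Finset.prod_nonneg fun i _ => hx i
  have h2 := pow_le_pow_left₀ (Real.rpow_nonneg hP _) h1 n
  rw [Real.rpow_inv_natCast_pow hP h.ne'] at h2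
  rwa [one_div, inv_mul_eq_div]

/-- **Optimality of the Vecchia approximation.**  For a Hermitian
positive-definite `A` and a sparsity pattern `S i ⊆ {0,…,i-1}`, the Vecchia
approximation `AV = CV⁻¹ · D̂_V · CV⁻ᴴ` — where the unit lower triangular `CV`
with sparsity pattern `S` satisfies `CV(i,Sᵢ)·A(Sᵢ,Sᵢ) + A(i,Sᵢ) = 0` and
`D̂_V(i,i) = (CV·A·CVᴴ)(i,i)` — minimizes the Kaporin condition number among
all inverse Cholesky approximations `C⁻¹ · D̂ · C⁻ᴴ` with the same sparsity
pattern and positive diagonal `D̂`. -/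
theorem vecchia_minimizes_kaporin
    (n : ℕ) (A : Matrix (Fin n) (Fin n) ℂ) (hA : A.PosDef)
    (S : Fin n → Finset (Fin n)) (hS : ∀ i : Fin n, ∀ j ∈ S i, j < i)
    (CV : Matrix (Fin n) (Fin n) ℂ) (hCV : UnitLowerTri CV)
    (hCVsparse : ∀ i j : Fin n, i ≠ j → j ∉ S i → CV i j = 0)
    (hCVeq : ∀ i : Fin n, ∀ j ∈ S i, (∑ k ∈ S i, CV i k * A k j) + A i j = 0)
    (AV : Matrix (Fin n) (Fin n) ℂ)
    (hAV : AV = CV⁻¹ * Matrix.diagonal (fun i => (CV * A * CVᴴ) i i) * (CV⁻¹)ᴴ)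
    (C : Matrix (Fin n) (Fin n) ℂ) (hC : UnitLowerTri C)
    (hCsparse : ∀ i j : Fin n, i ≠ j → j ∉ S i → C i j = 0)
    (dh : Fin n → ℝ) (hdh : ∀ i, 0 < dh i) :
    kaporin A AV ≤
      kaporin A (C⁻¹ * Matrix.diagonal (fun i => (dh i : ℂ)) * (C⁻¹)ᴴ) := by
  have hre : ∀ i, (((CV * A * CVᴴ) i i).re : ℂ) = (CV * A * CVᴴ) i i := fun i =>
    (Complex.eq_re_of_ofReal_le (r := 0) (by simpa using (row_pos A CV hA hCV i).le)).symm
  have hVpos : ∀ i, 0 < ((CV * A * CVᴴ) i i).re := fun i =>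
    (Complex.lt_def.1 (row_pos A CV hA hCV i)).1
  have hCpos : ∀ i, 0 < ((C * A * Cᴴ) i i).re := fun i =>
    (Complex.lt_def.1 (row_pos A C hA hC i)).1
  have hmin : ∀ i, ((CV * A * CVᴴ) i i).re ≤ ((C * A * Cᴴ) i i).re := fun i =>
    (Complex.le_def.1 (row_min A C CV hA S hS hCV hCVsparse hCVeq hC hCsparse i)).1
  have hdet : 0 < A.det.re := (Complex.lt_def.1 hA.det_pos).1
  have hV := kaporin_formula A CV hCV _ hVpos
  simp only [hre] at hV
  rw [hAV, hV, kaporin_formula A C hC dh hdh]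
  have hone : ((1 / (n : ℝ)) * ∑ i, ((CV * A * CVᴴ) i i).re / ((CV * A * CVᴴ) i i).re) ^ n = 1 := by
    rw [Finset.sum_congr rfl fun i _ => div_self (hVpos i).ne']
    rcases Nat.eq_zero_or_pos n with h | h
    · subst h; simp
    · have hn : (n : ℝ) ≠ 0 := by exact_mod_cast h.ne'
      simp [hn]
  rw [hone]
  have ham := amgm (fun i => ((C * A * Cᴴ) i i).re / dh i)
    (fun i => (div_pos (hCpos i) (hdh i)).le)
  rw [Finset.prod_div_distrib] at ham
  have hP1 : 0 < ∏ i, ((CV * A * CVᴴ) i i).re := Finset.prod_pos fun i _ => hVpos i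
  have hP2 : 0 < ∏ i, dh i := Finset.prod_pos fun i _ => hdh i
  have hP3 : ∏ i, ((CV * A * CVᴴ) i i).re ≤ ∏ i, ((C * A * Cᴴ) i i).re :=
    Finset.prod_le_prod (fun i _ => (hVpos i).le) fun i _ => hmin i
  rw [Finset.prod_inv_distrib, Finset.prod_inv_distrib]
  calc 1 / (A.det.re * (∏ i, ((CV * A * CVᴴ) i i).re)⁻¹)
      = (∏ i, ((CV * A * CVᴴ) i i).re) / A.det.re := by field_simp
    _ ≤ (∏ i, ((C * A * Cᴴ) i i).re) / A.det.re := by gcongr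
    _ = ((∏ i, ((C * A * Cᴴ) i i).re) / ∏ i, dh i) / (A.det.re * (∏ i, dh i)⁻¹) := by
        field_simp
    _ ≤ _ := by gcongr
end

section
/- Let A ∈ ℂ^{n×n} be Hermitian positive-definite and let S_i ⊆ {1,…,i−1} for i = 1,…,n be a sparsity pattern. Let Ĉ_V be the unique unit lower triangular matrix with Ĉ_V(i,j) = 0 for j ∉ S_i ∪ {i} satisfying Ĉ_V(i,S_i)·A(S_i,S_i) + A(i,S_i) = 0 for every i, let D̂_V(i,i) = (Ĉ_V·A·Ĉ_V*)(i,i), and set Â_V = Ĉ_V⁻¹·D̂_V·Ĉ_V⁻*. Then the Kaporin condition number of Â_V equals the product over i = 1,…,n of q_i(S_i) / q_i({1,…,i−1}), where q_i(T) := inf { (e_i+v)*·A·(e_i+v) : v ∈ ℂⁿ with v(j) = 0 for all j ∉ T } is the squared A-weighted distance from the standard basis vector e_i to the span of {e_j : j ∈ T}. -/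
open Matrix
open scoped ComplexOrder

/-- The squared `A`-weighted distance
`q_i(T) = inf { (e_i+v)* A (e_i+v) : v supported on T }`
from the standard basis vector `e_i` to `span{e_j : j ∈ T}`. -/
noncomputable def sqDist {n : ℕ} (A : Matrix (Fin n) (Fin n) ℂ)
    (i : Fin n) (T : Set (Fin n)) : ℝ :=
  sInf {x : ℝ | ∃ v : Fin n → ℂ, (∀ j : Fin n, j ∉ T → v j = 0) ∧
    x = (star (Pi.single i 1 + v) ⬝ᵥ A *ᵥ (Pi.single i 1 + v)).re}

lemma vk_quad {n : ℕ} (A : Matrix (Fin n) (Fin n) ℂ)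
    (i : Fin n) (T : Set (Fin n)) (w : Fin n → ℂ) (hi : w i = 1)
    (hw : ∀ j, j ≠ i → j ∉ T → w j = 0) (hAw : ∀ j ∈ T, (A *ᵥ w) j = 0) :
    star w ⬝ᵥ A *ᵥ w = (A *ᵥ w) i := by
  rw [dotProduct, Finset.sum_eq_single i]
  · simp [hi]
  · intro j _ hj
    by_cases h : j ∈ T
    · rw [hAw j h, mul_zero]
    · simp [hw j hj h]
  · simp

lemma vk_sqDist {n : ℕ} (A : Matrix (Fin n) (Fin n) ℂ) (hA : A.PosDef)
    (i : Fin n) (T : Set (Fin n)) (hiT : i ∉ T) (w : Fin n → ℂ) (hi : w i = 1)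
    (hw : ∀ j, j ≠ i → j ∉ T → w j = 0) (hAw : ∀ j ∈ T, (A *ᵥ w) j = 0) :
    0 < sqDist A i T ∧ ((sqDist A i T : ℝ) : ℂ) = star w ⬝ᵥ A *ᵥ w := by
  have hw0 : w ≠ 0 := by
    intro h
    rw [h] at hi
    simp at hi
  have hpos : 0 < star w ⬝ᵥ A *ᵥ w := hA.dotProduct_mulVec_pos hw0
  have hpos' := Complex.pos_iff.1 hpos
  have key : sqDist A i T = (star w ⬝ᵥ A *ᵥ w).re := by
    apply IsLeast.csInf_eq
    refine ⟨⟨w - Pi.single i 1, ?_, ?_⟩, ?_⟩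
    · intro j hj
      by_cases h : j = i
      · subst h; simp [hi]
      · simp [h, hw j h hj]
    · simp
    · rintro x ⟨v, hv, rfl⟩
      set u : Fin n → ℂ := Pi.single i 1 + v - w with hu
      have huT : ∀ j, j ∉ T → u j = 0 := by
        intro j hj
        by_cases h : j = i
        · subst h; simp [hu, hi, hv j hj]
        · simp [hu, h, hw j h hj, hv j hj]
      have e : Pi.single i 1 + v = w + u := by simp [hu]
      have c1 : star u ⬝ᵥ A *ᵥ w = 0 := by
        rw [dotProduct]
        apply Finset.sum_eq_zero
        intro j _
        by_cases h : j ∈ T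
        · rw [hAw j h, mul_zero]
        · simp [huT j h]
      have c2 : star w ⬝ᵥ A *ᵥ u = 0 := by
        have : star (star u ⬝ᵥ A *ᵥ w) = star w ⬝ᵥ A *ᵥ u := by
          rw [star_dotProduct, star_mulVec, hA.1.eq, ← dotProduct_mulVec, star_star]
        rw [← this, c1, star_zero]
      have c3 := (Complex.nonneg_iff.1 (hA.posSemidef.dotProduct_mulVec_nonneg u)).1
      rw [e, star_add, mulVec_add, add_dotProduct, dotProduct_add, dotProduct_add, c1, c2]
      simp only [Complex.add_re, Complex.zero_re]
      linarith
  refine ⟨key ▸ hpos'.1, ?_⟩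
  rw [key]
  apply Complex.ext
  · simp
  · simpa using hpos'.2

lemma vk_exists {n : ℕ} (A : Matrix (Fin n) (Fin n) ℂ) (hA : A.PosDef)
    (i : Fin n) : ∃ w : Fin n → ℂ, w i = 1 ∧
    (∀ j, j ≠ i → j ∉ {j : Fin n | j < i} → w j = 0) ∧
    (∀ j ∈ {j : Fin n | j < i}, (A *ᵥ w) j = 0) := by
  let M : Matrix {j : Fin n // j < i} {j : Fin n // j < i} ℂ := A.submatrix (↑) (↑)
  have hM : M.PosDef := hA.submatrix Subtype.val_injective
  have hu : IsUnit M.det := hM.isUnit.map Matrix.detMonoidHom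
  let x : {j : Fin n // j < i} → ℂ := M⁻¹ *ᵥ (fun j : {j : Fin n // j < i} => - A j.1 i)
  have hx : M *ᵥ x = fun j : {j : Fin n // j < i} => - A j.1 i := by
    simp only [x]
    rw [mulVec_mulVec, Matrix.mul_nonsing_inv _ hu, one_mulVec]
  refine ⟨fun j => if h : j < i then x ⟨j, h⟩ else if j = i then 1 else 0, by simp, ?_, ?_⟩
  · intro j hj hji
    have : ¬ j < i := hji
    simp [this, hj]
  · intro j hj
    have h1 := congrFun hx ⟨j, hj⟩
    simp only [mulVec, dotProduct, M, submatrix_apply] at h1 ⊢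
    have h2 : ∀ k : Fin n, A j k * (if h : k < i then x ⟨k, h⟩ else if k = i then 1 else 0)
        = (if h : k < i then A j k * x ⟨k, h⟩ else 0) + (if k = i then A j k else 0) := by
      intro k
      by_cases h : k < i
      · simp [h, h.ne]
      · by_cases h' : k = i <;> simp [h, h']
    simp only [h2, Finset.sum_add_distrib, Finset.sum_ite_eq', Finset.mem_univ, if_true]
    have h3 : ∑ k : Fin n, (if h : k < i then A j k * x ⟨k, h⟩ else 0)
        = ∑ k : {k : Fin n // k < i}, A j k * x k := by
      have h4 := Finset.sum_subtype (p := fun k => k < i) (F := inferInstance)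
        (Finset.univ.filter (fun k => k < i)) (by simp)
        (fun k : Fin n => if h : k < i then A j k * x ⟨k, h⟩ else 0)
      rw [Finset.sum_filter_of_ne] at h4
      · rw [h4]
        refine Finset.sum_congr rfl fun k _ => ?_
        simp [k.2]
      · intro k _ hk
        by_contra h
        simp [h] at hk
    rw [h3, h1]; simp

lemma vk_det {n : ℕ} (A : Matrix (Fin n) (Fin n) ℂ) (hA : A.PosDef) :
    A.det = ∏ i : Fin n, ((sqDist A i {j : Fin n | j < i} : ℝ) : ℂ) := by
  choose w h1 h2 h3 using vk_exists A hA
  let B : Matrix (Fin n) (Fin n) ℂ := Matrix.of fun j i => w i j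
  have hB : B.det = 1 := by
    rw [det_of_upperTriangular]
    · simp [B, h1]
    · intro j i hij
      exact h2 i j (ne_of_gt hij) (not_lt.2 (le_of_lt hij))
  have hAB : (A * B).det = ∏ i, (A * B) i i := by
    apply det_of_lowerTriangular
    intro j i hij
    exact h3 i j hij
  rw [det_mul, hB, mul_one] at hAB
  rw [hAB]
  refine Finset.prod_congr rfl fun i _ => ?_
  rw [(vk_sqDist A hA i {j : Fin n | j < i} (lt_irrefl i) (w i) (h1 i) (h2 i) (h3 i)).2,
    vk_quad A i _ (w i) (h1 i) (h2 i) (h3 i)]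
  rfl

theorem vecchia_kaporin_eq_prod_sqDist
    (n : ℕ) (A : Matrix (Fin n) (Fin n) ℂ) (hA : A.PosDef)
    (S : Fin n → Finset (Fin n)) (hS : ∀ i : Fin n, ∀ j ∈ S i, j < i)
    (CV : Matrix (Fin n) (Fin n) ℂ) (hCV : UnitLowerTri CV)
    (hCVsparse : ∀ i j : Fin n, i ≠ j → j ∉ S i → CV i j = 0)
    (hCVeq : ∀ i : Fin n, ∀ j ∈ S i, (∑ k ∈ S i, CV i k * A k j) + A i j = 0)
    (AV : Matrix (Fin n) (Fin n) ℂ)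
    (hAV : AV = CV⁻¹ * Matrix.diagonal (fun i => (CV * A * CVᴴ) i i) * (CV⁻¹)ᴴ) :
    kaporin A AV =
      ∏ i : Fin n, sqDist A i (↑(S i)) / sqDist A i {j : Fin n | j < i} := by
  have hiS : ∀ i, i ∉ S i := fun i h => lt_irrefl i (hS i i h)
  have hq : ∀ i, 0 < sqDist A i (↑(S i)) ∧
      ((sqDist A i (↑(S i)) : ℝ) : ℂ) = (CV * A * CVᴴ) i i := by
    intro i
    have := vk_sqDist A hA i (↑(S i)) (by simpa using hiS i) (star (CV i))
      (by simp [hCV.1 i])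
      (by intro j hj hjS
          simp [hCVsparse i j hj.symm (by simpa using hjS)])
      (by intro j hj
          have hj' : j ∈ S i := by simpa using hj
          have h := hCVeq i j hj'
          have h' : ∑ k, CV i k * A k j = 0 := by
            rw [← h, ← Finset.sum_subset (Finset.subset_univ (insert i (S i))),
              Finset.sum_insert (hiS i), hCV.1 i, one_mul, add_comm]
            intro k _ hk
            rw [Finset.mem_insert, not_or] at hk
            rw [hCVsparse i k (Ne.symm hk.1) hk.2, zero_mul]
          have h'' := congrArg star h'
          rw [star_zero, star_sum] at h''
          rw [← h'', mulVec, dotProduct]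
          refine Finset.sum_congr rfl fun k _ => ?_
          rw [star_mul, hA.1.apply, Pi.star_apply])
    refine ⟨this.1, this.2.trans ?_⟩
    rw [star_star, dotProduct_mulVec]
    rfl
  set q : Fin n → ℝ := fun i => sqDist A i (↑(S i)) with hqd
  have hD : (fun i => (CV * A * CVᴴ) i i) = fun i => ((q i : ℝ) : ℂ) := by
    funext i; exact (hq i).2.symm
  have hq0 : ∀ i, ((q i : ℝ) : ℂ) ≠ 0 := fun i => by exact_mod_cast (hq i).1.ne'
  have hdetC : CV.det = 1 := by
    rw [det_of_lowerTriangular]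
    · simp [hCV.1]
    · intro i j hij
      exact hCV.2 i j hij
  have hCu : IsUnit CV.det := by simp [hdetC]
  have hCHu : IsUnit CVᴴ.det := by simp [det_conjTranspose, hdetC]
  have hinv : AV⁻¹ = CVᴴ * (Matrix.diagonal fun i => ((q i : ℝ) : ℂ)⁻¹) * CV := by
    apply inv_eq_right_inv
    rw [hAV, hD, conjTranspose_nonsing_inv]
    have e1 : CVᴴ⁻¹ * CVᴴ = 1 := nonsing_inv_mul _ hCHu
    have e2 : CV⁻¹ * CV = 1 := nonsing_inv_mul _ hCu
    have e3 : (Matrix.diagonal fun i => ((q i : ℝ) : ℂ)) *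
        (Matrix.diagonal fun i => ((q i : ℝ) : ℂ)⁻¹) = 1 := by
      rw [diagonal_mul_diagonal]
      simp [hq0]
    calc _ = CV⁻¹ * ((Matrix.diagonal fun i => ((q i : ℝ) : ℂ)) * (CVᴴ⁻¹ * CVᴴ) *
        (Matrix.diagonal fun i => ((q i : ℝ) : ℂ)⁻¹)) * CV := by simp only [Matrix.mul_assoc]
      _ = 1 := by rw [e1, Matrix.mul_one, e3, Matrix.mul_one, e2]
  have htr : (A * AV⁻¹).trace = n := by
    rw [hinv, ← Matrix.mul_assoc, trace_mul_comm, ← Matrix.mul_assoc, ← Matrix.mul_assoc, trace]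
    simp only [diag_apply, mul_diagonal]
    have : ∀ i, (CV * A * CVᴴ) i i * ((q i : ℝ) : ℂ)⁻¹ = 1 := by
      intro i
      rw [← (hq i).2]
      exact mul_inv_cancel₀ (hq0 i)
    simp [this]
  have hdet : (A * AV⁻¹).det = (((∏ i, sqDist A i {j : Fin n | j < i}) * (∏ i, q i)⁻¹ : ℝ) : ℂ) := by
    rw [hinv, det_mul, det_mul, det_mul, det_conjTranspose, hdetC, det_diagonal, vk_det A hA]
    push_cast
    simp
  rw [kaporin, htr, hdet, Complex.ofReal_re, Finset.prod_div_distrib]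
  have h1 : ((1 / (n : ℝ)) * ((n : ℂ)).re) ^ n = 1 := by
    rcases Nat.eq_zero_or_pos n with h | h
    · subst h; simp
    · have : (n : ℝ) ≠ 0 := by positivity
      simp [this]
  rw [h1]
  simp [div_eq_mul_inv, mul_comm, hqd]
end

section
/- Let A ∈ ℂ^{n×n} be Hermitian positive-semidefinite, let i ∈ {1,…,n}, and let S ⊆ {1,…,n} with i ∉ S. Let B be any matrix indexed by S×S satisfying A(S,S)·B·A(S,S) = A(S,S). Then inf { (e_i+v)*·A·(e_i+v) : v ∈ ℂⁿ with v(j) = 0 for all j ∉ S } = A(i,i) − A(i,S)·B·A(S,i), the infimum is attained, and in particular the value A(i,i) − A(i,S)·B·A(S,i) is a nonnegative real number independent of the choice of B. -/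
open Matrix
open scoped ComplexOrder

/-- **Squared A-weighted distance via a generalized inverse.**
For a Hermitian positive-semidefinite `A`, an index `i ∉ S`, and any
generalized inverse `B` of the principal submatrix `A(S,S)` (i.e.
`A(S,S)·B·A(S,S) = A(S,S)`), the infimum of `(e_i+v)* A (e_i+v)` over vectors
`v` supported on `S` is attained and equals `A(i,i) − A(i,S)·B·A(S,i)`, which
is in particular a nonnegative real number (independent of `B`). -/
theorem sqDist_eq_schur_complement
    (n : ℕ) (A : Matrix (Fin n) (Fin n) ℂ) (hA : A.PosSemidef)
    (i : Fin n) (S : Finset (Fin n)) (hiS : i ∉ S)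
    (B : Matrix S S ℂ)
    (hB : A.submatrix Subtype.val Subtype.val * B *
        A.submatrix Subtype.val Subtype.val
      = A.submatrix Subtype.val Subtype.val)
    (c : ℂ)
    (hc : c = A i i - (fun j : S => A i j.val) ⬝ᵥ B *ᵥ (fun k : S => A k.val i)) :
    IsLeast {x : ℝ | ∃ v : Fin n → ℂ, (∀ j : Fin n, j ∉ S → v j = 0) ∧
        x = (star (Pi.single i 1 + v) ⬝ᵥ A *ᵥ (Pi.single i 1 + v)).re} c.re ∧
    c.im = 0 ∧ 0 ≤ c.re := by
  obtain ⟨C, hC⟩ : ∃ C : Matrix (Fin n) (Fin n) ℂ, A = Cᴴ * C := by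
    open scoped MatrixOrder Matrix.Norms.L2Operator in
    exact CStarAlgebra.nonneg_iff_eq_star_mul_self.mp hA.nonneg
  set G : Matrix S S ℂ := A.submatrix Subtype.val Subtype.val with hG
  set b : S → ℂ := fun k : S => A k.val i with hb
  set K : Matrix (Fin n) S ℂ := C.submatrix id Subtype.val with hK
  have hGK : G = Kᴴ * K := by
    rw [hG, hC, hK]; ext a b; simp [Matrix.mul_apply]
  have hbK : b = Kᴴ *ᵥ (fun k => C k i) := by
    rw [hb, hC, hK]; ext a; simp [Matrix.mul_apply, Matrix.mulVec, dotProduct]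
  have hPK : (G * B - 1) * Kᴴ = 0 := by
    rw [← Matrix.self_mul_conjTranspose_eq_zero, Matrix.conjTranspose_mul,
      Matrix.conjTranspose_conjTranspose, Matrix.mul_assoc, ← Matrix.mul_assoc Kᴴ K, ← hGK,
      ← Matrix.mul_assoc, Matrix.sub_mul, hB, Matrix.one_mul, sub_self, Matrix.zero_mul]
  have hGb : G *ᵥ (B *ᵥ b) = b := by
    have h : (G * B - 1) *ᵥ b = 0 := by
      rw [hbK, Matrix.mulVec_mulVec, hPK, Matrix.zero_mulVec]
    rw [Matrix.sub_mulVec, Matrix.one_mulVec, sub_eq_zero] at h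
    rw [Matrix.mulVec_mulVec, h]
  set v0 : Fin n → ℂ := fun j => if h : j ∈ S then -(B *ᵥ b) ⟨j, h⟩ else 0 with hv0
  have hv0S : ∀ j, j ∉ S → v0 j = 0 := fun j hj => by simp [hv0, hj]
  have hAv0 : ∀ k, (A *ᵥ v0) k = - ((fun j : S => A k j.val) ⬝ᵥ B *ᵥ b) := by
    intro k
    have h1 : (A *ᵥ v0) k = ∑ j ∈ S, A k j * v0 j := by
      simp only [Matrix.mulVec, dotProduct]
      symm
      apply Finset.sum_subset (Finset.subset_univ S)
      intro j _ hj
      rw [hv0S j hj, mul_zero]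
    rw [h1, ← Finset.sum_coe_sort S, dotProduct, ← Finset.sum_neg_distrib]
    refine Finset.sum_congr rfl fun j _ => ?_
    simp [hv0]
  set x0 : Fin n → ℂ := Pi.single i 1 + v0 with hx0
  have hAx : ∀ k, (A *ᵥ x0) k = A k i - ((fun j : S => A k j.val) ⬝ᵥ B *ᵥ b) := by
    intro k
    rw [hx0, Matrix.mulVec_add, Pi.add_apply, hAv0, sub_eq_add_neg]
    simp
  have hAxS : ∀ k, k ∈ S → (A *ᵥ x0) k = 0 := by
    intro k hk
    have h := congrFun hGb ⟨k, hk⟩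
    rw [hAx, sub_eq_zero]
    exact h.symm
  have hort : ∀ d : Fin n → ℂ, (∀ j, j ∉ S → d j = 0) → star d ⬝ᵥ A *ᵥ x0 = 0 := by
    intro d hd
    refine Finset.sum_eq_zero fun j _ => ?_
    by_cases hj : j ∈ S
    · rw [hAxS j hj, mul_zero]
    · simp [hd j hj]
  have hort2 : ∀ d : Fin n → ℂ, (∀ j, j ∉ S → d j = 0) → star x0 ⬝ᵥ A *ᵥ d = 0 := by
    intro d hd
    have h := congrArg star (hort d hd)
    rw [star_zero, ← star_dotProduct_star, star_star, Matrix.star_mulVec, hA.1.eq,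
      ← Matrix.dotProduct_mulVec] at h
    exact h
  have hcx : star x0 ⬝ᵥ A *ᵥ x0 = c := by
    have h : star x0 = star (Pi.single i 1 : Fin n → ℂ) + star v0 := by rw [hx0, star_add]
    rw [h, add_dotProduct, hort v0 hv0S, add_zero, hc, ← hAx i]
    rw [← Pi.single_star]
    simp
  have hc0 : 0 ≤ c := hcx ▸ hA.dotProduct_mulVec_nonneg x0
  have hc1 := Complex.le_def.mp hc0
  refine ⟨⟨⟨v0, hv0S, by rw [← hx0, hcx]⟩, ?_⟩, hc1.2.symm, hc1.1⟩
  rintro _ ⟨v, hv, rfl⟩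
  have hd : ∀ j, j ∉ S → (v - v0) j = 0 := fun j hj => by simp [hv j hj, hv0S j hj]
  have hx : (Pi.single i 1 + v : Fin n → ℂ) = x0 + (v - v0) := by rw [hx0]; abel
  rw [hx, star_add, Matrix.mulVec_add, add_dotProduct, dotProduct_add, dotProduct_add,
    hort _ hd, hort2 _ hd, hcx, add_zero, zero_add, Complex.add_re]
  have := (Complex.le_def.mp (hA.dotProduct_mulVec_nonneg (v - v0))).1
  rw [Complex.zero_re] at this
  linarith
end

section
/- Let C ∈ ℂ^{n×n} be unit lower triangular, let D ∈ ℝ^{n×n} be a nonnegative diagonal matrix, and set A = C⁻¹·D·C⁻*. Let Q ∈ ℂ^{n×k} have orthonormal columns (Q*·Q = I) whose span equals the range of A, and let D⁺ be the diagonal matrix with D⁺(i,i) = 1/D(i,i) when D(i,i) > 0 and D⁺(i,i) = 0 otherwise. Then the matrix B = Q·Q*·C*·D⁺·C·Q·Q* is the Moore–Penrose pseudoinverse of A; that is, A·B·A = A, B·A·B = B, (A·B)* = A·B, and (B·A)* = B·A. -/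
open Matrix

/-- **Pseudoinverse formula for an inverse Cholesky decomposition.**
Let `A = C⁻¹·D·C⁻ᴴ` with `C` unit lower triangular and `D` nonnegative
diagonal.  Let `Q` have orthonormal columns spanning the range of `A`, and let
`D⁺` be the entrywise pseudoinverse of `D`.  Then `B = Q·Qᴴ·Cᴴ·D⁺·C·Q·Qᴴ`
satisfies the four Penrose conditions, i.e. it is the Moore–Penrose
pseudoinverse of `A`. -/
theorem pseudoinverse_of_inverse_cholesky
    (n k : ℕ)
    (C : Matrix (Fin n) (Fin n) ℂ) (hC : UnitLowerTri C)
    (d : Fin n → ℝ) (hd : ∀ i, 0 ≤ d i)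
    (A : Matrix (Fin n) (Fin n) ℂ)
    (hA : A = C⁻¹ * Matrix.diagonal (fun i => (d i : ℂ)) * (C⁻¹)ᴴ)
    (Q : Matrix (Fin n) (Fin k) ℂ) (hQ : Qᴴ * Q = 1)
    (hrange : LinearMap.range Q.mulVecLin = LinearMap.range A.mulVecLin)
    (Dpinv : Matrix (Fin n) (Fin n) ℂ)
    (hDpinv : Dpinv =
      Matrix.diagonal (fun i => if 0 < d i then (((d i)⁻¹ : ℝ) : ℂ) else 0))
    (B : Matrix (Fin n) (Fin n) ℂ)
    (hB : B = Q * Qᴴ * Cᴴ * Dpinv * C * Q * Qᴴ) :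
    A * B * A = A ∧ B * A * B = B ∧ (A * B)ᴴ = A * B ∧ (B * A)ᴴ = B * A := by
  have hdet : IsUnit C.det := by
    rw [Matrix.det_of_lowerTriangular C (fun i j hij => hC.2 i j hij)]
    simp [hC.1]
  have h1 : C * C⁻¹ = 1 := Matrix.mul_nonsing_inv C hdet
  have h1' : (C⁻¹)ᴴ * Cᴴ = 1 := by
    rw [← Matrix.conjTranspose_mul, h1, Matrix.conjTranspose_one]
  set D : Matrix (Fin n) (Fin n) ℂ := Matrix.diagonal (fun i => (d i : ℂ)) with hD
  have hDD : D * Dpinv * D = D := by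
    rw [hDpinv, hD, Matrix.diagonal_mul_diagonal, Matrix.diagonal_mul_diagonal]
    congr 1
    funext i
    by_cases h : 0 < d i
    · have : (d i : ℂ) ≠ 0 := by exact_mod_cast h.ne'
      simp [h, this]
    · have : d i = 0 := le_antisymm (not_lt.mp h) (hd i)
      simp [this]
  have hDH : Dᴴ = D := by
    rw [hD, Matrix.diagonal_conjTranspose]
    congr 1
    funext i
    simp
  have hPH : Dpinvᴴ = Dpinv := by
    rw [hDpinv, Matrix.diagonal_conjTranspose]
    congr 1
    funext i
    by_cases h : 0 < d i <;> simp [h]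
  have hAH : Aᴴ = A := by
    rw [hA]
    simp only [Matrix.conjTranspose_mul, Matrix.conjTranspose_conjTranspose, hDH, Matrix.mul_assoc]
  obtain ⟨G, hG⟩ : ∃ G, G = Cᴴ * Dpinv * C := ⟨_, rfl⟩
  have hGH : Gᴴ = G := by
    rw [hG]
    simp only [Matrix.conjTranspose_mul, Matrix.conjTranspose_conjTranspose, hPH, Matrix.mul_assoc]
  have hAGA : A * G * A = A := by
    calc A * G * A = C⁻¹ * D * ((C⁻¹)ᴴ * Cᴴ) * Dpinv * (C * C⁻¹) * D * (C⁻¹)ᴴ := by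
          rw [hA, hG]; simp only [Matrix.mul_assoc]
      _ = C⁻¹ * (D * Dpinv * D) * (C⁻¹)ᴴ := by
          rw [h1, h1']; simp only [Matrix.mul_assoc, Matrix.mul_one, Matrix.one_mul]
      _ = A := by rw [hDD, hA]
  have key : ∀ {m p q : ℕ} (M : Matrix (Fin m) (Fin p) ℂ) (N : Matrix (Fin m) (Fin q) ℂ),
      LinearMap.range M.mulVecLin ≤ LinearMap.range N.mulVecLin → ∃ X : Matrix (Fin q) (Fin p) ℂ, M = N * X := by
    intro m p q M N h
    have hx : ∀ j, ∃ x, N *ᵥ x = M.col j := by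
      intro j
      have : M.col j ∈ LinearMap.range M.mulVecLin := ⟨Pi.single j 1, by simp⟩
      obtain ⟨x, hx⟩ := h this
      exact ⟨x, by simpa using hx⟩
    choose x hx using hx
    refine ⟨Matrix.of fun i j => x j i, ?_⟩
    ext i j
    exact (congrFun (hx j) i).symm
  obtain ⟨X, hX⟩ := key Q A hrange.le
  obtain ⟨Y, hY⟩ := key A Q hrange.ge
  obtain ⟨P, hP⟩ : ∃ P, P = Q * Qᴴ := ⟨_, rfl⟩
  have hPH : Pᴴ = P := by simp [hP]
  have hPP : P * P = P := by
    rw [hP, Matrix.mul_assoc, ← Matrix.mul_assoc Qᴴ, hQ, Matrix.one_mul]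
  have hPA : P * A = A := by
    rw [hP, hY, Matrix.mul_assoc, ← Matrix.mul_assoc Qᴴ, hQ, Matrix.one_mul]
  have hAP : A * P = A := by
    have := congrArg Matrix.conjTranspose hPA
    rwa [Matrix.conjTranspose_mul, hAH, hPH] at this
  have hPX : P = A * (X * Qᴴ) := by rw [← Matrix.mul_assoc, ← hX, hP]
  have hB' : B = P * G * P := by
    rw [hB, hP, hG]; simp only [Matrix.mul_assoc]
  have hBH : Bᴴ = B := by
    rw [hB']; simp only [Matrix.conjTranspose_mul, hPH, hGH, Matrix.mul_assoc]
  have hAB : A * B = P := by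
    calc A * B = (A * P) * G * P := by rw [hB']; simp only [Matrix.mul_assoc]
      _ = A * G * (A * (X * Qᴴ)) := by rw [hAP, ← hPX]
      _ = (A * G * A) * (X * Qᴴ) := by simp only [Matrix.mul_assoc]
      _ = P := by rw [hAGA, ← hPX]
  have hBA : B * A = P := by
    have := congrArg Matrix.conjTranspose hAB
    rwa [Matrix.conjTranspose_mul, hAH, hBH, hPH] at this
  refine ⟨by rw [hAB, hPA], ?_, by rw [hAB, hPH], by rw [hBA, hPH]⟩
  rw [hBA, hB', ← Matrix.mul_assoc, ← Matrix.mul_assoc, hPP]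
end

section
/- Let C ∈ ℂ^{n×n} be unit lower triangular, let D ∈ ℝ^{n×n} be a nonnegative diagonal matrix, and set A = C⁻¹·D·C⁻*. Let G = {i : D(i,i) > 0}, let R ∈ ℂ^{n×|G|} be the matrix whose columns are the standard basis vectors e_i for i ∈ G, and let Q ∈ ℂ^{n×|G|} have orthonormal columns whose span equals the range of A. Then vol(A)·|det(R*·Q)|² = ∏_{i∈G} D(i,i), where vol(A) denotes the product of the strictly positive eigenvalues of the Hermitian matrix A. -/
open Matrix

/-- The volume of a Hermitian matrix: the product of its strictly positive
eigenvalues (counted with multiplicity). -/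
noncomputable def vol {n : ℕ} {A : Matrix (Fin n) (Fin n) ℂ}
    (hA : A.IsHermitian) : ℝ :=
  ∏ i ∈ Finset.univ.filter (fun i => 0 < hA.eigenvalues i), hA.eigenvalues i

/-- **Volume formula for an inverse Cholesky decomposition.**
Let `A = C⁻¹·D·C⁻ᴴ` with `C` unit lower triangular and `D` nonnegative
diagonal, let `G = {i : D(i,i) > 0}`, let `R` have columns `e_i` for `i ∈ G`,
and let `Q` have orthonormal columns spanning the range of `A`.  Then
`vol(A)·|det(Rᴴ·Q)|² = ∏_{i∈G} D(i,i)`. -/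
theorem vol_of_inverse_cholesky
    (n : ℕ)
    (C : Matrix (Fin n) (Fin n) ℂ) (hC : UnitLowerTri C)
    (d : Fin n → ℝ) (hd : ∀ i, 0 ≤ d i)
    (A : Matrix (Fin n) (Fin n) ℂ)
    (hA : A = C⁻¹ * Matrix.diagonal (fun i => (d i : ℂ)) * (C⁻¹)ᴴ)
    (hAH : A.IsHermitian)
    (G : Finset (Fin n)) (hG : G = Finset.univ.filter (fun i => 0 < d i))
    (R : Matrix (Fin n) G ℂ)
    (hR : ∀ (i : Fin n) (j : G), R i j = if i = (j : Fin n) then 1 else 0)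
    (Q : Matrix (Fin n) G ℂ) (hQ : Qᴴ * Q = 1)
    (hrange : LinearMap.range Q.mulVecLin = LinearMap.range A.mulVecLin) :
    vol hAH * Complex.normSq (Rᴴ * Q).det = ∏ i ∈ G, d i := by
  have hdet : C.det = 1 := by
    rw [Matrix.det_of_isLowerTriangular C (fun i j h => hC.2 i j h)]
    simp [hC.1]
  have hu : IsUnit C.det := by simp [hdet]
  have hCC : C * C⁻¹ = 1 := Matrix.mul_nonsing_inv C hu
  have hAps : ∀ i, 0 ≤ hAH.eigenvalues i := by
    open ComplexOrder in
    have h : A.PosSemidef := by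
      rw [hA]
      apply Matrix.PosSemidef.mul_mul_conjTranspose_same
      refine Matrix.PosSemidef.diagonal ?_
      intro i
      simpa using hd i
    exact h.eigenvalues_nonneg
  have hLt : ∀ i j : Fin n, i < j → C⁻¹ i j = 0 := by
    let := Matrix.invertibleOfIsUnitDet C hu
    intro i j hij
    exact Matrix.blockTriangular_inv_of_blockTriangular
      (b := OrderDual.toDual) (M := C) (fun i j h => hC.2 i j h) hij
  have hLd : ∀ i, C⁻¹ i i = 1 := by
    intro i
    have h := congrFun (congrFun hCC i) i
    rw [Matrix.mul_apply, Finset.sum_eq_single i] at h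
    · simpa [hC.1] using h
    · intro k _ hk
      rcases lt_or_gt_of_ne hk with h1 | h1
      · rw [hLt k i h1, mul_zero]
      · rw [hC.2 i k h1, zero_mul]
    · simp
  generalize C⁻¹ = L at hA hLt hLd
  set DG : Matrix G G ℂ := Matrix.diagonal (fun i => (d i : ℂ)) with hDG
  have hD : Matrix.diagonal (fun i => (d i : ℂ)) = R * DG * Rᴴ := by
    ext i j
    rw [Matrix.mul_apply]
    simp only [hDG, Matrix.mul_diagonal, Matrix.conjTranspose_apply, hR]
    have : ∀ k : G, (if i = (k : Fin n) then (1:ℂ) else 0) * (d k : ℂ) *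
        star (if j = (k : Fin n) then (1:ℂ) else 0) =
        (fun k : Fin n => if i = k then (if j = k then (d k : ℂ) else 0) else 0) k := by
      intro k
      by_cases h1 : i = k <;> by_cases h2 : j = k <;> simp [h1, h2]
    rw [Finset.sum_congr rfl (fun k _ => this k), Finset.sum_coe_sort G
      (fun k : Fin n => if i = k then (if j = k then (d k : ℂ) else 0) else 0)]
    rw [Finset.sum_ite_eq]
    by_cases hi : i ∈ G
    · simp [hi, Matrix.diagonal_apply, eq_comm]
    · have : d i = 0 := by
        have h1 : ¬ 0 < d i := by simpa [hG] using hi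
        exact le_antisymm (not_lt.mp h1) (hd i)
      simp [hi, Matrix.diagonal_apply, this]
  have hRL : (Rᴴ * (L * R)).det = 1 := by
    have he : Rᴴ * (L * R) = L.submatrix (fun i : G => (i : Fin n)) (fun i : G => (i : Fin n)) := by
      ext i j
      simp [Matrix.mul_apply, hR]
    rw [he, Matrix.det_of_isLowerTriangular
      (L.submatrix (fun i : G => (i : Fin n)) (fun i : G => (i : Fin n)))
      (fun i j h => hLt i j h)]
    simp [hLd]
  have hAL : A = (L * R) * DG * (L * R)ᴴ := by
    rw [hA, hD, Matrix.conjTranspose_mul]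
    simp only [Matrix.mul_assoc]
  generalize L * R = K at hRL hAL
  have hfac : ∀ {p : Type} [Fintype p] [DecidableEq p] (X : Matrix (Fin n) p ℂ) (Y : Matrix (Fin n) G ℂ),
      LinearMap.range X.mulVecLin ≤ LinearMap.range Y.mulVecLin → ∃ M : Matrix G p ℂ, X = Y * M := by
    intro p _ _ X Y h
    have : ∀ j, ∃ v, Y *ᵥ v = X *ᵥ Pi.single j 1 := fun j => h ⟨Pi.single j 1, rfl⟩
    choose v hv using this
    refine ⟨Matrix.of fun i j => v j i, ?_⟩
    ext i j
    have := congrFun (hv j) i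
    rw [Matrix.mulVec_single_one] at this
    exact this.symm
  obtain ⟨N, hN⟩ := hfac A Q hrange.ge
  obtain ⟨M, hM⟩ := hfac Q K (by
    rw [hrange, hAL, Matrix.mul_assoc, Matrix.mulVecLin_mul]
    exact LinearMap.range_comp_le_range _ _)
  have hAQ : A = Q * (Qᴴ * A) := by
    conv_rhs => rw [hN, ← Matrix.mul_assoc Qᴴ, hQ, Matrix.one_mul]
    exact hN
  have hdM : (Rᴴ * Q).det = M.det := by
    rw [hM, ← Matrix.mul_assoc, Matrix.det_mul, hRL, one_mul]
  have h1 : (Qᴴ * K).det * M.det = 1 := by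
    rw [← Matrix.det_mul, Matrix.mul_assoc, ← hM, hQ, Matrix.det_one]
  set B := Qᴴ * A * Q with hB
  have hBdet : B.det = (Qᴴ * K).det * star (Qᴴ * K).det * ∏ i ∈ G, (d i : ℂ) := by
    have : B = (Qᴴ * K) * DG * (Qᴴ * K)ᴴ := by
      rw [hB, hAL, Matrix.conjTranspose_mul, Matrix.conjTranspose_conjTranspose]
      simp only [Matrix.mul_assoc]
    rw [this, Matrix.det_mul, Matrix.det_mul, Matrix.det_conjTranspose, hDG, Matrix.det_diagonal,
      Finset.prod_coe_sort G (fun i => (d i : ℂ))]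
    ring
  have hB0 : B.det ≠ 0 := by
    rw [hBdet]
    have h2 : (Qᴴ * K).det ≠ 0 := left_ne_zero_of_mul_eq_one h1
    refine mul_ne_zero (mul_ne_zero h2 (star_ne_zero.mpr h2)) (Finset.prod_ne_zero_iff.mpr ?_)
    intro i hi
    rw [hG] at hi
    have := (Finset.mem_filter.mp hi).2
    exact_mod_cast this.ne'
  have hvol : ((vol hAH : ℝ) : ℂ) = B.det := by
    have hc := Matrix.charpoly_mul_comm' Q (Qᴴ * A)
    rw [← hAQ, ← hB] at hc
    have hz : ∀ k : ℕ, Multiset.filter (fun x : ℂ => x ≠ 0) (k • {0}) = 0 := by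
      intro k
      rw [Multiset.filter_eq_nil]
      intro a ha
      have := Multiset.mem_of_mem_nsmul ha
      simpa using this
    have hr := congrArg (fun p => (Polynomial.roots p).filter (· ≠ 0)) hc
    rw [Polynomial.roots_mul (mul_ne_zero (pow_ne_zero _ Polynomial.X_ne_zero) (Matrix.charpoly_monic _).ne_zero),
      Polynomial.roots_mul (mul_ne_zero (pow_ne_zero _ Polynomial.X_ne_zero) (Matrix.charpoly_monic _).ne_zero),
      Polynomial.roots_X_pow, Polynomial.roots_X_pow, Multiset.filter_add, Multiset.filter_add,
      hz, hz, zero_add, zero_add] at hr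
    have hBf : B.charpoly.roots.filter (· ≠ 0) = B.charpoly.roots := by
      rw [Multiset.filter_eq_self]
      rintro a ha rfl
      apply hB0
      rw [Matrix.det_eq_prod_roots_charpoly]
      exact Multiset.prod_eq_zero ha
    rw [Matrix.det_eq_prod_roots_charpoly, ← hBf, ← hr, hAH.roots_charpoly_eq_eigenvalues,
      Multiset.filter_map, vol, Complex.ofReal_prod, Finset.prod]
    congr 2
    rw [Finset.filter_val]
    apply Multiset.filter_congr
    intro i _
    have := hAps i
    have e : (0 < hAH.eigenvalues i) ↔ ((hAH.eigenvalues i : ℂ) ≠ 0) := by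
      rw [Complex.ofReal_ne_zero]
      exact ⟨fun h => h.ne', fun h => lt_of_le_of_ne this h.symm⟩
    exact e
  have hfin : ((vol hAH * Complex.normSq (Rᴴ * Q).det : ℝ) : ℂ) = ((∏ i ∈ G, d i : ℝ) : ℂ) := by
    rw [Complex.ofReal_mul, hvol, hdM, hBdet, Complex.normSq_eq_conj_mul_self, Complex.ofReal_prod]
    have h2 : star (Qᴴ * K).det * star M.det = 1 := by
      rw [← star_mul', h1, star_one]
    have h3 : (starRingEnd ℂ) M.det = star M.det := rfl
    rw [h3]
    linear_combination (∏ i ∈ G, (d i : ℂ)) * ((Qᴴ * K).det * M.det) * h2 + (∏ i ∈ G, (d i : ℂ)) * h1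
  exact_mod_cast hfin
end

section
/- Let C, Ĉ ∈ ℂ^{n×n} be unit lower triangular, let D, D̂ ∈ ℝ^{n×n} be nonnegative diagonal matrices, and set A = C⁻¹·D·C⁻* and Â = Ĉ⁻¹·D̂·Ĉ⁻*. Assume A and Â have the same range, and let B be the Moore–Penrose pseudoinverse of Â (the unique matrix with Â·B·Â = Â, B·Â·B = B, (Â·B)* = Â·B, (B·Â)* = B·Â). Then tr(B·A) = tr(D̂⁺·Ĉ·A·Ĉ*), where D̂⁺ is the diagonal matrix with D̂⁺(i,i) = 1/D̂(i,i) when D̂(i,i) > 0 and D̂⁺(i,i) = 0 otherwise. -/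
open Matrix

/-- **Trace formula.**  If `A = C⁻¹·D·C⁻ᴴ` and `Â = Ĉ⁻¹·D̂·Ĉ⁻ᴴ` are inverse
Cholesky decompositions with the same range and `B` is the Moore–Penrose
pseudoinverse of `Â`, then `tr(B·A) = tr(D̂⁺·Ĉ·A·Ĉᴴ)`, where `D̂⁺` is the
entrywise pseudoinverse of the diagonal matrix `D̂`. -/
theorem trace_pinv_mul_eq
    (n : ℕ)
    (C Chat : Matrix (Fin n) (Fin n) ℂ)
    (hC : UnitLowerTri C) (hChat : UnitLowerTri Chat)
    (d dh : Fin n → ℝ) (hd : ∀ i, 0 ≤ d i) (hdh : ∀ i, 0 ≤ dh i)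
    (A Ahat : Matrix (Fin n) (Fin n) ℂ)
    (hA : A = C⁻¹ * Matrix.diagonal (fun i => (d i : ℂ)) * (C⁻¹)ᴴ)
    (hAhat : Ahat = Chat⁻¹ * Matrix.diagonal (fun i => (dh i : ℂ)) * (Chat⁻¹)ᴴ)
    (hrange : LinearMap.range A.mulVecLin = LinearMap.range Ahat.mulVecLin)
    (B : Matrix (Fin n) (Fin n) ℂ)
    (hB1 : Ahat * B * Ahat = Ahat) (hB2 : B * Ahat * B = B)
    (hB3 : (Ahat * B)ᴴ = Ahat * B) (hB4 : (B * Ahat)ᴴ = B * Ahat)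
    (Dpinv : Matrix (Fin n) (Fin n) ℂ)
    (hDpinv : Dpinv =
      Matrix.diagonal (fun i => if 0 < dh i then (((dh i)⁻¹ : ℝ) : ℂ) else 0)) :
    (B * A).trace = (Dpinv * Chat * A * Chatᴴ).trace := by
  have hdet : IsUnit Chat.det := by
    have h : Chat.det = 1 := by
      rw [Matrix.det_of_lowerTriangular Chat (fun i j hij => hChat.2 i j (by simpa using hij))]
      simp [hChat.1]
    rw [h]; exact isUnit_one
  have hAH : Aᴴ = A := by
    rw [hA]
    simp only [conjTranspose_mul, conjTranspose_conjTranspose, diagonal_conjTranspose, Matrix.mul_assoc]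
    congr 3
    ext i; simp
  have hAhH : Ahatᴴ = Ahat := by
    rw [hAhat]
    simp only [conjTranspose_mul, conjTranspose_conjTranspose, diagonal_conjTranspose, Matrix.mul_assoc]
    congr 3
    ext i; simp
  have hX : ∃ X, A = Ahat * X := by
    have h1 : ∀ j, ∃ v, Ahat *ᵥ v = A *ᵥ (Pi.single j 1) := by
      intro j
      have : A.mulVecLin (Pi.single j 1) ∈ LinearMap.range Ahat.mulVecLin :=
        hrange ▸ LinearMap.mem_range_self _ _
      obtain ⟨v, hv⟩ := this
      exact ⟨v, hv⟩
    choose v hv using h1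
    refine ⟨Matrix.of (fun i j => v j i), ?_⟩
    ext i j
    have := congrFun (hv j) i
    simp only [mulVec_single_one, col_apply] at this
    rw [← this]; rfl
  obtain ⟨X, hX⟩ := hX
  have e1 : A = Ahat * B * A := by
    rw [hX, ← Matrix.mul_assoc, hB1]
  have e2 : A = A * Bᴴ * Ahat := by
    have := congrArg conjTranspose e1
    simpa only [conjTranspose_mul, hAH, hAhH, Matrix.mul_assoc] using this
  have e3 : A = Ahat * (B * A * Bᴴ) * Ahat := by
    calc A = A * Bᴴ * Ahat := e2
      _ = (Ahat * B * A) * Bᴴ * Ahat := by rw [← e1]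
      _ = _ := by simp only [Matrix.mul_assoc]
  have key : ∀ G, Ahat * G * Ahat = Ahat → (G * A).trace = (Ahat * (B * A * Bᴴ)).trace := by
    intro G hG
    generalize B * A * Bᴴ = Y at e3
    rw [e3, ← Matrix.mul_assoc, Matrix.trace_mul_comm, ← Matrix.mul_assoc, ← Matrix.mul_assoc, hG]
  have hc1 : Chat * Chat⁻¹ = 1 := Matrix.mul_nonsing_inv _ hdet
  have hc2 : (Chat⁻¹)ᴴ * Chatᴴ = 1 := by rw [← conjTranspose_mul, hc1, conjTranspose_one]
  have hD : Matrix.diagonal (fun i => (dh i : ℂ)) * Dpinv * Matrix.diagonal (fun i => (dh i : ℂ))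
      = Matrix.diagonal (fun i => (dh i : ℂ)) := by
    rw [hDpinv, diagonal_mul_diagonal, diagonal_mul_diagonal]
    congr 1
    ext i
    rcases (hdh i).eq_or_lt with h | h
    · simp [← h]
    · have : (dh i : ℂ) ≠ 0 := by exact_mod_cast h.ne'
      simp [h, this]
  have hG : Ahat * (Chatᴴ * Dpinv * Chat) * Ahat = Ahat := by
    rw [hAhat]
    generalize Matrix.diagonal (fun i => (dh i : ℂ)) = E at hD
    calc _ = Chat⁻¹ * (E * (((Chat⁻¹)ᴴ * Chatᴴ) * Dpinv * (Chat * Chat⁻¹)) * E) * (Chat⁻¹)ᴴ := by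
          simp only [Matrix.mul_assoc]
      _ = _ := by rw [hc1, hc2, Matrix.one_mul, Matrix.mul_one, hD]
  rw [key B hB1, ← key _ hG, Matrix.trace_mul_comm _ Chatᴴ]
  simp only [Matrix.mul_assoc]
end

section
/- Let A, Â ∈ ℂ^{n×n} be Hermitian positive-definite with tr(A·Â⁻¹) = n. Let b, x₀ ∈ ℂⁿ, let x⋆ = A⁻¹·b, and let x̂ = x₀ + Â⁻¹·(b − A·x₀). Then (x̂ − x⋆)*·A·(x̂ − x⋆) ≤ 2·n·log(κ) · (x₀ − x⋆)*·A·(x₀ − x⋆), where κ = det(Â)/det(A) is a real number ≥ 1 (equal under the trace normalization to the Kaporin condition number ((1/n)·tr(A·Â⁻¹))ⁿ / det(A·Â⁻¹)). -/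
open Matrix
open scoped ComplexOrder

theorem aux_scalar (n l : ℝ) (hn : 1 ≤ n) (hl : 0 < l) (hln : l ≤ n) :
    (1 - l) ^ 2 ≤ 2 * n * (l - 1 - Real.log l) := by
  have hg : 0 ≤ l - 1 - Real.log l := by linarith [Real.log_le_sub_one_of_pos hl]
  rcases le_total l 1 with h | h
  · have hs : |1 - l| < 1 := by rw [abs_lt]; constructor <;> linarith
    have h0 : 0 ≤ 1 - l := by linarith
    have h1 := Real.hasSum_pow_div_log_of_abs_lt_one hs
    have h2 := sum_le_hasSum (Finset.range 2) (fun i _ => by positivity) h1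
    simp [Finset.sum_range_succ] at h2
    norm_num at h2
    nlinarith
  · have h1 : Real.log l ≤ (l - l⁻¹) / 2 := by
      rw [← Real.sinh_log hl]
      exact Real.self_le_sinh_iff.2 (Real.log_nonneg h)
    have h2 : (1 - l) ^ 2 = 2 * l * (l - 1 - (l - l⁻¹) / 2) := by
      field_simp
      ring
    calc (1 - l) ^ 2 = 2 * l * (l - 1 - (l - l⁻¹) / 2) := h2
      _ ≤ 2 * l * (l - 1 - Real.log l) := by gcongr
      _ ≤ 2 * n * (l - 1 - Real.log l) := by gcongr

theorem aux_sum (n : ℕ) (l : Fin n → ℝ) (hl : ∀ i, 0 < l i) (hs : ∑ i, l i = n) (j : Fin n) :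
    (1 - l j) ^ 2 ≤ 2 * n * (- Real.log (∏ i, l i)) := by
  have hn : (1 : ℝ) ≤ n := by
    have : 1 ≤ n := by have := j.2; omega
    exact_mod_cast this
  have hj : l j ≤ n := by
    rw [← hs]
    exact Finset.single_le_sum (fun i _ => (hl i).le) (Finset.mem_univ j)
  have h1 : - Real.log (∏ i, l i) = ∑ i, (l i - 1 - Real.log (l i)) := by
    rw [Real.log_prod (fun i _ => (hl i).ne')]
    simp [Finset.sum_sub_distrib, hs]
  have h2 : l j - 1 - Real.log (l j) ≤ ∑ i, (l i - 1 - Real.log (l i)) :=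
    Finset.single_le_sum (f := fun i => l i - 1 - Real.log (l i))
      (fun i _ => by linarith [Real.log_le_sub_one_of_pos (hl i)]) (Finset.mem_univ j)
  rw [h1]
  refine (aux_scalar n (l j) hn (hl j) hj).trans ?_
  gcongr

theorem aux_psd (n : ℕ) (M : Matrix (Fin n) (Fin n) ℂ) (hM : M.PosDef)
    (htr : M.trace = (n : ℂ)) :
    (((2 * n * (- Real.log M.det.re) : ℝ) : ℂ) • (1 : Matrix (Fin n) (Fin n) ℂ)
      - (1 - M) * (1 - M)).PosSemidef := by
  set l := hM.1.eigenvalues with hl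
  have hsum : ∑ i, l i = n := by
    have := hM.1.trace_eq_sum_eigenvalues
    rw [htr] at this
    have h2 : (n : ℂ) = ((∑ i, l i : ℝ) : ℂ) := by rw [this]; push_cast; rfl
    exact_mod_cast h2.symm
  have hdet : M.det.re = ∏ i, l i := by
    have := hM.1.det_eq_prod_eigenvalues
    have h2 : M.det = ((∏ i, l i : ℝ) : ℂ) := by rw [this]; push_cast; rfl
    rw [h2, Complex.ofReal_re]
  rw [hdet]
  set c : ℝ := 2 * n * (- Real.log (∏ i, l i)) with hc
  have key := fun j => aux_sum n l hM.eigenvalues_pos hsum j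
  set U : Matrix (Fin n) (Fin n) ℂ := (hM.1.eigenvectorUnitary).1 with hU
  have hUU : U * Uᴴ = 1 := Unitary.coe_mul_star_self hM.1.eigenvectorUnitary
  have hUU' : Uᴴ * U = 1 := Unitary.coe_star_mul_self hM.1.eigenvectorUnitary
  set D : Matrix (Fin n) (Fin n) ℂ := diagonal (fun i => (l i : ℂ)) with hD
  have hsp : M = U * D * Uᴴ := by
    have := hM.1.spectral_theorem
    rw [Unitary.conjStarAlgAut_apply] at this
    exact this
  have h1 : 1 - M = U * (1 - D) * Uᴴ := by
    rw [mul_sub, sub_mul, ← hsp, mul_one, hUU]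
  have h2 : (c : ℂ) • (1 : Matrix (Fin n) (Fin n) ℂ) - (1 - M) * (1 - M)
      = U * diagonal (fun i => ((c - (1 - l i) ^ 2 : ℝ) : ℂ)) * Uᴴ := by
    have e : diagonal (fun i => ((c - (1 - l i) ^ 2 : ℝ) : ℂ))
        = (c : ℂ) • (1 : Matrix (Fin n) (Fin n) ℂ) - (1 - D) * (1 - D) := by
      rw [hD, ← diagonal_one, diagonal_sub, diagonal_mul_diagonal, ← diagonal_smul, diagonal_sub]
      congr 1
      ext i
      simp
      ring
    rw [e, h1, mul_sub U (_ • _), sub_mul (U * _ • _), Matrix.mul_smul, mul_one, Matrix.smul_mul, hUU]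
    congr 1
    calc U * (1 - D) * Uᴴ * (U * (1 - D) * Uᴴ)
        = U * (1 - D) * (Uᴴ * U) * (1 - D) * Uᴴ := by simp only [mul_assoc]
      _ = _ := by rw [hUU', mul_one]; simp only [mul_assoc]
  rw [h2]
  refine PosSemidef.mul_mul_conjTranspose_same (PosSemidef.diagonal fun i => ?_) U
  have := key i
  exact Complex.zero_le_real.2 (by linarith)

open scoped MatrixOrder in
theorem aux_factor (n : ℕ) (A : Matrix (Fin n) (Fin n) ℂ) (hA : A.PosSemidef) :
    ∃ B : Matrix (Fin n) (Fin n) ℂ, A = Bᴴ * B :=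
  CStarAlgebra.nonneg_iff_eq_star_mul_self.mp hA.nonneg

/-- **Error bound for the approximate direct linear solver.**
Let `A, Â` be Hermitian positive-definite with the trace normalization
`tr(A·Â⁻¹) = n`, let `x⋆ = A⁻¹·b` and `x̂ = x₀ + Â⁻¹·(b − A·x₀)`.  Then
`‖x̂ − x⋆‖_A² ≤ 2·n·log(κ)·‖x₀ − x⋆‖_A²` where `κ = det(Â)/det(A)` (which
under the trace normalization equals the Kaporin condition number). -/
theorem approximate_direct_solver_bound
    (n : ℕ) (A Ahat : Matrix (Fin n) (Fin n) ℂ)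
    (hA : A.PosDef) (hAhat : Ahat.PosDef)
    (htr : (A * Ahat⁻¹).trace = (n : ℂ))
    (b x0 : Fin n → ℂ)
    (xstar : Fin n → ℂ) (hxstar : xstar = A⁻¹ *ᵥ b)
    (xhat : Fin n → ℂ) (hxhat : xhat = x0 + Ahat⁻¹ *ᵥ (b - A *ᵥ x0))
    (κ : ℝ) (hκ : κ = (Ahat.det).re / (A.det).re) :
    (star (xhat - xstar) ⬝ᵥ A *ᵥ (xhat - xstar)).re
      ≤ 2 * n * Real.log κ *
        (star (x0 - xstar) ⬝ᵥ A *ᵥ (x0 - xstar)).re := by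
  obtain ⟨B, hB⟩ := aux_factor n A hA.posSemidef
  have hAu : IsUnit A.det := (Matrix.isUnit_iff_isUnit_det _).1 hA.isUnit
  have hBu : IsUnit B := by
    rw [Matrix.isUnit_iff_isUnit_det]
    rw [hB, det_mul] at hAu
    exact isUnit_of_mul_isUnit_right hAu
  set M := B * Ahat⁻¹ * Bᴴ with hMdef
  have hM : M.PosDef := by
    refine hAhat.inv.mul_mul_conjTranspose_same ?_
    exact Matrix.vecMul_injective_iff_isUnit.2 hBu
  have hMtr : M.trace = n := by
    rw [← htr, hMdef, hB, trace_mul_comm, mul_assoc]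
  have hdA := hA.det_pos
  have hdH := hAhat.det_pos
  have hMdet : Real.log κ = - Real.log M.det.re := by
    have e : M.det = A.det / Ahat.det := by
      rw [hMdef, det_mul, det_mul, hB, det_mul, det_nonsing_inv, Ring.inverse_eq_inv']
      ring
    obtain ⟨a, ha⟩ : ∃ a : ℝ, A.det = a := ⟨A.det.re, by
      apply Complex.ext <;> simp [← (Complex.lt_def.1 hdA).2]⟩
    obtain ⟨h, hh⟩ : ∃ a : ℝ, Ahat.det = a := ⟨Ahat.det.re, by
      apply Complex.ext <;> simp [← (Complex.lt_def.1 hdH).2]⟩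
    rw [hκ, e, ha, hh, ← Complex.ofReal_div, Complex.ofReal_re, Complex.ofReal_re,
      Complex.ofReal_re, ← Real.log_inv, inv_div]
  have hP := (aux_psd n M hM hMtr).conjTranspose_mul_mul_same B
  rw [← hMdet] at hP
  set c : ℝ := 2 * n * Real.log κ with hc
  set E : Matrix (Fin n) (Fin n) ℂ := 1 - Ahat⁻¹ * A with hE
  have hBE : B * E = (1 - M) * B := by
    rw [hE, hMdef, hB, mul_sub, sub_mul, mul_one, one_mul]
    simp only [mul_assoc]
  have hEB : Eᴴ * Bᴴ = Bᴴ * (1 - M) := by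
    rw [← conjTranspose_mul, hBE, conjTranspose_mul, conjTranspose_sub, conjTranspose_one, hM.1.eq]
  have hmat : Bᴴ * ((c : ℂ) • (1 : Matrix (Fin n) (Fin n) ℂ) - (1 - M) * (1 - M)) * B
      = (c : ℂ) • A - Eᴴ * A * E := by
    have e1 : Eᴴ * A * E = Bᴴ * ((1 - M) * (1 - M)) * B := by
      calc Eᴴ * A * E = (Eᴴ * Bᴴ) * (B * E) := by rw [hB]; simp only [mul_assoc]
        _ = _ := by rw [hBE, hEB]; simp only [mul_assoc]
    rw [e1, mul_sub, sub_mul, Matrix.mul_smul, mul_one, Matrix.smul_mul, ← hB]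
  rw [hmat] at hP
  have herr : xhat - xstar = E *ᵥ (x0 - xstar) := by
    have hb : b = A *ᵥ xstar := by
      rw [hxstar, mulVec_mulVec, mul_nonsing_inv _ hAu, one_mulVec]
    rw [hxhat, hE, sub_mulVec, one_mulVec, ← mulVec_mulVec, mulVec_sub A, ← hb]
    rw [mulVec_sub, mulVec_sub]
    abel
  have hq := hP.re_dotProduct_nonneg (x0 - xstar)
  have e2 : star (xhat - xstar) ⬝ᵥ A *ᵥ (xhat - xstar)
      = star (x0 - xstar) ⬝ᵥ (Eᴴ * A * E) *ᵥ (x0 - xstar) := by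
    rw [herr, star_mulVec, ← dotProduct_mulVec, mulVec_mulVec, mulVec_mulVec]
  rw [e2]
  rw [sub_mulVec, dotProduct_sub, smul_mulVec, dotProduct_smul] at hq
  simp only [smul_eq_mul, RCLike.re_to_complex, Complex.sub_re, Complex.re_ofReal_mul] at hq
  linarith
end

section
/- Let r ≥ 1 and let λ₁, …, λ_r be strictly positive real numbers with λ₁ + ⋯ + λ_r = r. Then for every index i, (1 − λ_i)² ≤ 2·r·( − ∑_{j=1}^{r} log λ_j ). (Note that −∑_j log λ_j ≥ 0 by the AM–GM inequality.) -/
theorem log_aux (r x : ℝ) (hr : 1 ≤ r) (hx : 0 < x) (hxr : x ≤ r) :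
    (1 - x) ^ 2 ≤ 2 * r * (x - 1 - Real.log x) := by
  have hg : 0 ≤ x - 1 - Real.log x := by linarith [Real.log_le_sub_one_of_pos hx]
  rcases le_or_gt 1 x with h | h
  · have h1 : Real.log x ≤ Real.sinh (Real.log x) :=
      Real.self_le_sinh_iff.2 (Real.log_nonneg h)
    rw [Real.sinh_log hx] at h1
    have h2 : x * Real.log x ≤ x * ((x - x⁻¹) / 2) := mul_le_mul_of_nonneg_left h1 hx.le
    have h3 : x * ((x - x⁻¹) / 2) = (x ^ 2 - 1) / 2 := by field_simp
    have h4 := mul_le_mul_of_nonneg_right hxr hg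
    nlinarith
  · have hs := Real.hasSum_pow_div_log_of_abs_lt_one (x := 1 - x)
      (by rw [abs_lt]; constructor <;> linarith)
    have h1 := sum_le_hasSum (Finset.range 2)
      (fun n _ => div_nonneg (pow_nonneg (by linarith : (0:ℝ) ≤ 1 - x) _) (by positivity)) hs
    norm_num [Finset.sum_range_succ] at h1
    have h4 := mul_le_mul_of_nonneg_right hr hg
    nlinarith

/-- **Key scalar inequality for the approximate direct solver.**
If `λ₁, …, λ_r > 0` with `λ₁ + ⋯ + λ_r = r`, then for every `i`,
`(1 − λᵢ)² ≤ 2·r·(−∑ⱼ log λⱼ)`. -/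
theorem sq_one_sub_le_of_sum_eq
    (r : ℕ) (hr : 1 ≤ r) (lam : Fin r → ℝ)
    (hpos : ∀ i, 0 < lam i) (hsum : ∑ i, lam i = r) (i : Fin r) :
    (1 - lam i) ^ 2 ≤ 2 * r * (-∑ j, Real.log (lam j)) := by
  have hr' : (1:ℝ) ≤ r := by exact_mod_cast hr
  have hle : lam i ≤ r := by
    rw [← hsum]
    exact Finset.single_le_sum (fun j _ => (hpos j).le) (Finset.mem_univ i)
  have h1 : lam i - 1 - Real.log (lam i) ≤ ∑ j, (lam j - 1 - Real.log (lam j)) :=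
    Finset.single_le_sum (f := fun j => lam j - 1 - Real.log (lam j))
      (fun j _ => by linarith [Real.log_le_sub_one_of_pos (hpos j)]) (Finset.mem_univ i)
  have h2 : ∑ j, (lam j - 1 - Real.log (lam j)) = -∑ j, Real.log (lam j) := by
    simp [Finset.sum_sub_distrib, hsum]
  rw [h2] at h1
  exact (log_aux r (lam i) hr' (hpos i) hle).trans
    (mul_le_mul_of_nonneg_left h1 (by positivity))
end

section
/- Let r ≥ 1 be a real number and let x be a real number with 0 < x ≤ r. Then log x ≤ x − 1 − (x − 1)²/(2r). -/
/-- **Quadratic upper bound for the logarithm on `(0, r]`.**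
For real `r ≥ 1` and `0 < x ≤ r`, `log x ≤ x − 1 − (x − 1)²/(2r)`. -/
theorem log_le_quadratic_bound (r x : ℝ) (hr : 1 ≤ r) (hx : 0 < x)
    (hxr : x ≤ r) :
    Real.log x ≤ x - 1 - (x - 1) ^ 2 / (2 * r) := by
  have hr0 : 0 < r := by linarith
  let f : ℝ → ℝ := fun y => y - 1 - (y - 1) ^ 2 / (2 * r) - Real.log y
  have hd : ∀ y : ℝ, 0 < y → HasDerivAt f ((y - 1) * (r - y) / (r * y)) y := by
    intro y hy
    have h1 : HasDerivAt (fun y : ℝ => y - 1) 1 y := (hasDerivAt_id y).sub_const 1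
    have h := (h1.sub ((h1.pow 2).div_const (2 * r))).sub (Real.hasDerivAt_log hy.ne')
    refine h.congr_deriv ?_
    field_simp
    ring
  have hf1 : f 1 = 0 := by simp [f]
  suffices h : 0 ≤ f x by
    simp only [f] at h
    linarith
  rw [← hf1]
  rcases le_total x 1 with h | h
  · have hanti : AntitoneOn f (Set.Icc x 1) := by
      apply antitoneOn_of_deriv_nonpos (convex_Icc x 1)
      · exact fun y hy => (hd y (hx.trans_le hy.1)).continuousAt.continuousWithinAt
      · intro y hy
        rw [interior_Icc] at hy
        exact (hd y (hx.trans hy.1)).differentiableAt.differentiableWithinAt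
      · intro y hy
        rw [interior_Icc] at hy
        have hy0 := hx.trans hy.1
        rw [(hd y hy0).deriv]
        exact div_nonpos_of_nonpos_of_nonneg
          (mul_nonpos_of_nonpos_of_nonneg (by linarith [hy.2]) (by linarith [hy.2]))
          (by positivity)
    exact hanti ⟨le_refl x, h⟩ ⟨h, le_refl 1⟩ h
  · have hmono : MonotoneOn f (Set.Icc 1 x) := by
      apply monotoneOn_of_deriv_nonneg (convex_Icc 1 x)
      · exact fun y hy => (hd y (one_pos.trans_le hy.1)).continuousAt.continuousWithinAt
      · intro y hy
        rw [interior_Icc] at hy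
        exact (hd y (one_pos.trans hy.1)).differentiableAt.differentiableWithinAt
      · intro y hy
        rw [interior_Icc] at hy
        have hy0 : 0 < y := one_pos.trans hy.1
        rw [(hd y hy0).deriv]
        exact div_nonneg
          (mul_nonneg (by linarith [hy.1]) (by linarith [hy.2]))
          (by positivity)
    exact hmono ⟨le_refl 1, h⟩ ⟨h, le_refl x⟩ h
end

section
/- Let A, Â ∈ ℂ^{n×n} be Hermitian positive-definite, let κ = ((1/n)·tr(A·Â⁻¹))ⁿ / det(A·Â⁻¹) (a real number ≥ 1), let b, x₀ ∈ ℂⁿ, x⋆ = A⁻¹·b, and r₀ = b − A·x₀. Then for every integer t ≥ 1 there exists a polynomial q over ℝ of degree < t such that the vector x = x₀ + q(Â⁻¹·A)·(Â⁻¹·r₀) satisfies (x − x⋆)*·A·(x − x⋆) ≤ (3·log(κ)/t)ᵗ · (x₀ − x⋆)*·A·(x₀ − x⋆). Consequently the t-th iterate of preconditioned conjugate gradient with preconditioner Â, which minimizes the A-norm error over the affine Krylov subspace x₀ + span{(Â⁻¹·A)ʲ·Â⁻¹·r₀ : 0 ≤ j < t}, satisfies the same bound. -/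
open Matrix
open scoped ComplexOrder

/-- The squared `A`-norm (energy) of a vector: `v* · A · v` (real part). -/
noncomputable def energy {n : ℕ} (A : Matrix (Fin n) (Fin n) ℂ)
    (v : Fin n → ℂ) : ℝ :=
  (star v ⬝ᵥ A *ᵥ v).re


theorem pcg_amgm {ι : Type*} (s : Finset ι) (z : ι → ℝ) (hz : ∀ i ∈ s, 0 ≤ z i) :
    ∏ i ∈ s, z i ≤ ((∑ i ∈ s, z i) / s.card) ^ s.card := by
  rcases s.eq_empty_or_nonempty with rfl | hs
  · simp
  have hc : 0 < s.card := hs.card_pos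
  have hc' : (0:ℝ) < s.card := by exact_mod_cast hc
  have h := Real.geom_mean_le_arith_mean_weighted s (fun _ => (s.card:ℝ)⁻¹) z
    (fun _ _ => by positivity) (by simp; field_simp) hz
  rw [Real.finsetProd_rpow s z hz, ← Finset.mul_sum] at h
  have h2 := pow_le_pow_left₀ (Real.rpow_nonneg (Finset.prod_nonneg hz) _) h s.card
  rw [Real.rpow_inv_natCast_pow (Finset.prod_nonneg hz) hc.ne'] at h2
  rw [div_eq_inv_mul]; exact h2

theorem pcg_mahler (m : ℕ) (hm : 1 ≤ m) (c : ℕ → ℝ) (hc : ∀ k, 1 ≤ c k) :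
    ∏ k ∈ Finset.range m, (c k - 1) ≤
      (Real.exp ((∑ k ∈ Finset.range m, Real.log (c k)) / m) - 1) ^ m := by
  have hm0 : (0:ℝ) < m := by exact_mod_cast hm
  have hcp : ∀ k, 0 < c k := fun k => by linarith [hc k]
  set P := Real.exp ((∑ k ∈ Finset.range m, Real.log (c k)) / m) with hP
  have hPpos : 0 < P := Real.exp_pos _
  have hPm : P ^ m = ∏ k ∈ Finset.range m, c k := by
    rw [hP, ← Real.exp_nat_mul, mul_div_cancel₀ _ hm0.ne', Real.exp_sum]
    exact Finset.prod_congr rfl fun k _ => Real.exp_log (hcp k)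
  have hx0 : 0 ≤ ∏ k ∈ Finset.range m, (c k - 1) :=
    Finset.prod_nonneg fun k _ => by linarith [hc k]
  set G := (∏ k ∈ Finset.range m, (c k - 1)) ^ ((m:ℝ)⁻¹) with hG
  have hG0 : 0 ≤ G := Real.rpow_nonneg hx0 _
  have hGm : G ^ m = ∏ k ∈ Finset.range m, (c k - 1) :=
    Real.rpow_inv_natCast_pow hx0 (by omega)
  have h1 := pcg_amgm (Finset.range m) (fun k => (c k - 1) / c k)
    (fun k _ => div_nonneg (by linarith [hc k]) (hcp k).le)
  have h2 := pcg_amgm (Finset.range m) (fun k => 1 / c k)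
    (fun k _ => by have := hcp k; positivity)
  simp only [Finset.prod_div_distrib, Finset.card_range, Finset.prod_const_one, ← hPm, ← hGm] at h1 h2
  rw [← div_pow] at h1
  rw [← _root_.one_div_pow] at h2
  have h1' := le_of_pow_le_pow_left₀ (by omega) (div_nonneg (Finset.sum_nonneg
    (fun k _ => div_nonneg (by linarith [hc k]) (hcp k).le)) hm0.le) h1
  have h2' := le_of_pow_le_pow_left₀ (by omega) (div_nonneg (Finset.sum_nonneg
    (fun k _ => by have := hcp k; positivity)) hm0.le) h2
  have hs : (∑ k ∈ Finset.range m, (c k - 1) / c k) / m + (∑ k ∈ Finset.range m, 1 / c k) / m = 1 := by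
    rw [← add_div, ← Finset.sum_add_distrib]
    rw [Finset.sum_congr rfl (g := fun _ => (1:ℝ)) (fun k _ => by have := hcp k; field_simp; ring)]
    rw [Finset.sum_const, Finset.card_range, nsmul_eq_mul, mul_one, div_self hm0.ne']
  have : (G + 1) / P ≤ 1 := by rw [add_div]; linarith
  rw [div_le_one hPpos] at this
  rw [← hGm]
  exact pow_le_pow_left₀ hG0 (by linarith) m

theorem pcg_expb (u s : ℝ) (h0 : 0 ≤ u) (h1 : u ≤ 1) (hs : 1 ≤ s) (hu : u ≤ 2 * s / 3) :
    Real.exp u - 1 ≤ 3 / 2 * u * s := by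
  have h := Real.exp_bound' h0 h1 (n := 3) (by norm_num)
  simp [Finset.sum_range_succ, Nat.factorial] at h
  nlinarith [mul_nonneg h0 (sub_nonneg.2 hs), mul_nonneg h0 (sub_nonneg.2 hu), mul_nonneg h0 (sub_nonneg.2 h1),
    mul_nonneg (mul_nonneg h0 h0) (sub_nonneg.2 h1)]

theorem pcg_final_bound (m e t : ℕ) (he : e ≤ 1) (ht : t = 2 * m + e) (ht1 : 1 ≤ t) (c : ℕ → ℝ)
    (hc : ∀ k, 1 ≤ c k) (v L : ℝ) (hv : 0 ≤ v)
    (hL : ∑ k ∈ Finset.range m, Real.log (c k) + v ≤ L) (hLt : 3 * L / t < 1) :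
    (∏ k ∈ Finset.range m, (c k - 1)) ^ 2 * v ^ e ≤ (3 * L / t) ^ t := by
  rcases Nat.eq_zero_or_pos m with rfl | hm
  · have : e = 1 := by omega
    subst this
    simp at ht; subst ht
    simp at hL ⊢; linarith
  have hm0 : (0:ℝ) < m := by exact_mod_cast hm
  have hm1 : (1:ℝ) ≤ m := by exact_mod_cast hm
  have hM := pcg_mahler m hm c hc
  have hS : 0 ≤ ∑ k ∈ Finset.range m, Real.log (c k) :=
    Finset.sum_nonneg fun k _ => Real.log_nonneg (hc k)
  have hx0 : 0 ≤ ∏ k ∈ Finset.range m, (c k - 1) :=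
    Finset.prod_nonneg fun k _ => by linarith [hc k]
  have ht0 : (0:ℝ) < t := by exact_mod_cast ht1
  rw [div_lt_one ht0] at hLt
  set u := (∑ k ∈ Finset.range m, Real.log (c k)) / m with hu
  have hu0 : 0 ≤ u := by positivity
  have huS : ∑ k ∈ Finset.range m, Real.log (c k) = m * u := by rw [hu]; field_simp
  rw [huS] at hL
  have hpos : 0 ≤ Real.exp u - 1 := by linarith [Real.add_one_le_exp u]
  have key : ∀ s, 1 ≤ s → u ≤ 1 → u ≤ 2 * s / 3 →
      (∏ k ∈ Finset.range m, (c k - 1)) ^ 2 ≤ (3 / 2 * u * s) ^ (2 * m) := by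
    intro s hs h1 h2
    calc _ ≤ ((Real.exp u - 1) ^ m) ^ 2 := pow_le_pow_left₀ hx0 hM 2
      _ = (Real.exp u - 1) ^ (2 * m) := by rw [← pow_mul, mul_comm]
      _ ≤ _ := pow_le_pow_left₀ hpos (pcg_expb u s hu0 h1 hs h2) _
  have htr : (t:ℝ) = 2 * m + e := by rw [ht]; push_cast; ring
  interval_cases e
  · have hu2 : u ≤ 2 / 3 := by
      simp at htr; nlinarith
    have := key 1 le_rfl (by linarith) (by linarith)
    simp only [pow_zero, mul_one, add_zero] at this ht ⊢
    subst ht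
    refine this.trans (pow_le_pow_left₀ (by positivity) ?_ _)
    rw [le_div_iff₀ ht0]; push_cast; nlinarith
  · have hmi : (m:ℝ) * (1 / (2 * m)) = 1 / 2 := by field_simp
    set w : ℝ := 1 / (2 * m) with hw
    have hw0 : 0 < w := by positivity
    simp at htr
    have hu3 : u ≤ 2 * (1 + w) / 3 := by
      by_contra! hcon
      nlinarith
    have hw1 : w ≤ 1 / 2 := by nlinarith
    have h1 := key (1 + w) (by linarith) (by linarith) hu3
    have h2 : (1 + w) ^ (2 * m) ≤ 3 := by
      calc (1 + w) ^ (2 * m) ≤ (Real.exp w) ^ (2 * m) :=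
            pow_le_pow_left₀ (by linarith) (by linarith [Real.add_one_le_exp w]) _
        _ = Real.exp 1 := by rw [← Real.exp_nat_mul]; congr 1; push_cast; linarith
        _ ≤ 3 := by linarith [Real.exp_one_lt_d9]
    have h3 := pcg_amgm (Finset.range (2 * m + 1)) (fun k => if k < 2 * m then u / 2 else v)
      (fun k _ => by split_ifs <;> positivity)
    rw [Finset.prod_range_succ, Finset.sum_range_succ, Finset.card_range,
      Finset.prod_congr rfl (g := fun _ => u / 2) (fun k hk => by simp at hk; simp [hk]),
      Finset.sum_congr rfl (g := fun _ => u / 2) (fun k hk => by simp at hk; simp [hk])] at h3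
    simp only [Finset.prod_const, Finset.sum_const, Finset.card_range, lt_irrefl, if_false, nsmul_eq_mul] at h3
    rw [← ht] at h3
    have h4 : ((2 * m : ℕ) * (u / 2) + v) / (t:ℝ) ≤ L / t := by
      gcongr; push_cast; linarith
    have h4' : 0 ≤ ((2 * m : ℕ) * (u / 2) + v) / (t:ℝ) := by positivity
    have h5 := h3.trans (pow_le_pow_left₀ h4' h4 t)
    rw [pow_one]
    calc _ ≤ (3 / 2 * u * (1 + w)) ^ (2 * m) * v := by gcongr
      _ = 3 ^ (2 * m) * (1 + w) ^ (2 * m) * ((u / 2) ^ (2 * m) * v) := by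
          rw [← mul_assoc, ← mul_pow, ← mul_pow]; ring_nf
      _ ≤ 3 ^ (2 * m) * 3 * (L / t) ^ t := by gcongr
      _ = (3 * L / t) ^ t := by rw [mul_div_assoc, mul_pow, ← pow_succ, ← ht]


open Polynomial in
theorem pcg_poly {ι : Type*} [DecidableEq ι] (l : ι → ℝ) (hl : ∀ i, 0 < l i) (e : ℕ) (he : e ≤ 1) (m : ℕ) :
    ∀ S : Finset ι, ∃ (p : ℝ[X]) (c : ℕ → ℝ) (v : ℝ) (μ : ι → ℝ),
      p.natDegree ≤ 2 * m + e ∧ p.eval 0 = 1 ∧ (∀ k, 1 ≤ c k) ∧ 0 ≤ v ∧ (∀ i, 0 < μ i) ∧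
      (∀ i ∈ S, |p.eval (l i)| ^ 2 ≤ (∏ k ∈ Finset.range m, (c k - 1)) ^ 2 * v ^ e) ∧
      ∑ i ∈ S, μ i = ∑ i ∈ S, l i ∧
      ∏ i ∈ S, μ i = (∏ i ∈ S, l i) * (∏ k ∈ Finset.range m, c k) * Real.exp v := by
  -- choosing extreme elements
  have ext : ∀ S : Finset ι, 2 ≤ S.card → ∃ i j, ∃ T : Finset ι, i ≠ j ∧ i ∉ T ∧ j ∉ T ∧
      S = insert i (insert j T) ∧ l i ≤ l j ∧ ∀ k ∈ T, l i ≤ l k ∧ l k ≤ l j := by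
    intro S hS
    obtain ⟨i, hi, hmin⟩ := S.exists_min_image l (Finset.card_pos.1 (by omega))
    obtain ⟨j, hj, hmax⟩ := (S.erase i).exists_max_image l
      (Finset.card_pos.1 (by rw [Finset.card_erase_of_mem hi]; omega))
    refine ⟨i, j, (S.erase i).erase j, (Finset.ne_of_mem_erase hj).symm, by simp, by simp, ?_,
      hmin j (Finset.mem_of_mem_erase hj), fun k hk => ?_⟩
    · rw [Finset.insert_erase hj, Finset.insert_erase hi]
    · have hk' := Finset.mem_of_mem_erase hk
      exact ⟨hmin k (Finset.mem_of_mem_erase hk'), hmax k hk'⟩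
  -- small sets
  have small : ∀ S : Finset ι, ¬ 2 ≤ S.card → ∃ p : ℝ[X], p.natDegree ≤ 1 ∧ p.eval 0 = 1 ∧
      ∀ i ∈ S, p.eval (l i) = 0 := by
    intro S hS
    rcases S.eq_empty_or_nonempty with rfl | ⟨i, hi⟩
    · exact ⟨1, by simp, by simp, by simp⟩
    · refine ⟨1 - C (l i)⁻¹ * X, by compute_degree, by simp, fun k hk => ?_⟩
      have : k = i := Finset.card_le_one.1 (by omega) k hk i hi
      subst this
      simp [(hl k).ne']
  have cge : ∀ a b : ℝ, 0 < a → 0 < b → 1 ≤ ((a + b) / 2) ^ 2 / (a * b) := by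
    intro a b ha hb
    rw [le_div_iff₀ (by positivity)]; nlinarith [sq_nonneg (a - b)]
  induction m with
  | zero =>
    intro S
    interval_cases e
    · exact ⟨1, fun _ => 1, 0, l, by simp, by simp, by simp, le_rfl, hl, by simp, rfl, by simp⟩
    by_cases hS : 2 ≤ S.card
    · obtain ⟨i, j, T, hij, hiT, hjT, rfl, hlij, hT⟩ := ext S hS
      have hi := hl i
      have hj := hl j
      have hc := cge _ _ hi hj
      set a := l i with ha
      set b := l j with hb
      set cc := ((a + b) / 2) ^ 2 / (a * b) with hcc
      refine ⟨1 - C ((a + b) / 2)⁻¹ * X, fun _ => 1, Real.log cc,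
        fun k => if k = i ∨ k = j then (a + b) / 2 else l k, by simpa using (by compute_degree), by simp, by simp, Real.log_nonneg hc,
        fun k => by have := hl k; dsimp only; split_ifs <;> positivity, fun k hk => ?_, ?_, ?_⟩
      · have hk' : a ≤ l k ∧ l k ≤ b := by
          rw [Finset.mem_insert, Finset.mem_insert] at hk
          rcases hk with rfl | rfl | hk
          · exact ⟨le_rfl, hlij⟩
          · exact ⟨hlij, le_rfl⟩
          · exact hT k hk
        simp only [eval_sub, eval_one, eval_mul, eval_C, eval_X, sq_abs, Finset.range_zero,
          Finset.prod_empty, one_pow, one_mul, pow_one]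
        have h1 : 1 - cc⁻¹ ≤ Real.log cc := Real.one_sub_inv_le_log_of_pos (by linarith)
        refine le_trans ?_ h1
        have h2 : 1 - cc⁻¹ = (b - a) ^ 2 / (a + b) ^ 2 := by
          rw [hcc]; field_simp; ring
        have h3 : (1 - ((a + b) / 2)⁻¹ * l k) ^ 2 = (a + b - 2 * l k) ^ 2 / (a + b) ^ 2 := by
          field_simp
        rw [h2, h3]
        gcongr ?_ / _
        nlinarith
      · rw [Finset.sum_insert (by simp [hij, hiT]), Finset.sum_insert hjT,
          Finset.sum_insert (by simp [hij, hiT]), Finset.sum_insert hjT,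
          Finset.sum_congr (s₁ := T) rfl (g := l) (fun k hk => by
            rw [if_neg]; rintro (rfl | rfl) <;> contradiction)]
        simp; ring
      · rw [Finset.prod_insert (by simp [hij, hiT]), Finset.prod_insert hjT,
          Finset.prod_insert (by simp [hij, hiT]), Finset.prod_insert hjT,
          Finset.prod_congr (s₁ := T) rfl (g := l) (fun k hk => by
            rw [if_neg]; rintro (rfl | rfl) <;> contradiction),
          Real.exp_log (by linarith)]
        simp [← ha, ← hb, hcc]; field_simp
    · obtain ⟨p, h1, h2, h3⟩ := small S hS
      exact ⟨p, fun _ => 1, 0, l, by omega, h2, by simp, le_rfl, hl,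
        fun i hi => by simp [h3 i hi], rfl, by simp⟩
  | succ m ih =>
    intro S
    by_cases hS : 2 ≤ S.card
    · obtain ⟨i, j, T, hij, hiT, hjT, rfl, hlij, hT⟩ := ext S hS
      have hi := hl i
      have hj := hl j
      have hc := cge _ _ hi hj
      set a := l i with ha
      set b := l j with hb
      set cc := ((a + b) / 2) ^ 2 / (a * b) with hcc
      obtain ⟨p, c, v, μ, hp, hp0, hc1, hv, hμ, hb1, hs, hpr⟩ := ih T
      have hrange : ∀ k ∈ Finset.range m, (if k < m then c k else cc) = c k := fun k hk => by
        simp at hk; simp [hk]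
      have hprodc : ∏ k ∈ Finset.range (m + 1), (if k < m then c k else cc) =
          (∏ k ∈ Finset.range m, c k) * cc := by
        rw [Finset.prod_range_succ, Finset.prod_congr rfl hrange]; simp
      have hprodx : ∏ k ∈ Finset.range (m + 1), ((if k < m then c k else cc) - 1) =
          (∏ k ∈ Finset.range m, (c k - 1)) * (cc - 1) := by
        rw [Finset.prod_range_succ, Finset.prod_congr rfl (fun k hk => by rw [hrange k hk])]; simp
      refine ⟨p * ((1 - C a⁻¹ * X) * (1 - C b⁻¹ * X)), fun k => if k < m then c k else cc, v,
        fun k => if k = i ∨ k = j then (a + b) / 2 else μ k, ?_, by simp [hp0], ?_, hv,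
        fun k => by have := hμ k; dsimp only; split_ifs <;> positivity, fun k hk => ?_, ?_, ?_⟩
      · refine natDegree_mul_le.trans ?_
        have : ((1 - C a⁻¹ * X) * (1 - C b⁻¹ * X)).natDegree ≤ 2 := by compute_degree
        omega
      · intro k; dsimp only; split_ifs
        · exact hc1 k
        · exact hc
      · rw [hprodx]
        simp only [eval_sub, eval_one, eval_mul, eval_C, eval_X]
        rw [Finset.mem_insert, Finset.mem_insert] at hk
        rcases hk with rfl | rfl | hk
        · rw [← ha, inv_mul_cancel₀ hi.ne']; simp; positivity
        · rw [← hb, inv_mul_cancel₀ hj.ne']; simp; positivity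
        · rw [abs_mul, mul_pow, mul_pow]
          have h1 := hb1 k hk
          obtain ⟨h2, h3⟩ := hT k hk
          have h4 : |(1 - a⁻¹ * l k) * (1 - b⁻¹ * l k)| ≤ cc - 1 := by
            have e1 : (1 - a⁻¹ * l k) * (1 - b⁻¹ * l k) = (a - l k) * (b - l k) / (a * b) := by
              field_simp
            have e2 : cc - 1 = ((b - a) / 2) ^ 2 / (a * b) := by
              rw [hcc]; field_simp; ring
            rw [e1, e2, abs_div, abs_of_pos (mul_pos hi hj)]
            gcongr ?_ / _
            rw [abs_le]
            constructor <;> nlinarith [sq_nonneg (a + b - 2 * l k), mul_nonneg (sub_nonneg.2 h2) (sub_nonneg.2 h3)]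
          have h5 := pow_le_pow_left₀ (abs_nonneg _) h4 2
          calc _ ≤ ((∏ k ∈ Finset.range m, (c k - 1)) ^ 2 * v ^ e) * (cc - 1) ^ 2 := by gcongr
            _ = _ := by ring
      · rw [Finset.sum_insert (by simp [hij, hiT]), Finset.sum_insert hjT,
          Finset.sum_insert (by simp [hij, hiT]), Finset.sum_insert hjT,
          Finset.sum_congr (s₁ := T) rfl (g := μ) (fun k hk => by
            rw [if_neg]; rintro (rfl | rfl) <;> contradiction), hs]
        simp; ring
      · rw [Finset.prod_insert (by simp [hij, hiT]), Finset.prod_insert hjT,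
          Finset.prod_insert (by simp [hij, hiT]), Finset.prod_insert hjT,
          Finset.prod_congr (s₁ := T) rfl (g := μ) (fun k hk => by
            rw [if_neg]; rintro (rfl | rfl) <;> contradiction), hpr, hprodc]
        simp [← ha, ← hb, hcc]; field_simp
    · obtain ⟨p, h1, h2, h3⟩ := small S hS
      exact ⟨p, fun _ => 1, 0, l, by omega, h2, by simp, le_rfl, hl,
        fun i hi => by simp [h3 i hi], rfl, by simp⟩

open scoped MatrixOrder in
theorem pcg_sqrt {n : ℕ} (A : Matrix (Fin n) (Fin n) ℂ) (hA : A.PosDef) :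
    ∃ G : Matrix (Fin n) (Fin n) ℂ, A = Gᴴ * G := by
  exact (CStarAlgebra.nonneg_iff_eq_star_mul_self (a := A)).1 hA.posSemidef.nonneg

theorem pcg_diag {n : ℕ} (A Ahat : Matrix (Fin n) (Fin n) ℂ)
    (hA : A.PosDef) (hAhat : Ahat.PosDef) :
    ∃ (W : Matrix (Fin n) (Fin n) ℂ) (d : Fin n → ℝ), (∀ i, 0 < d i) ∧ A = Wᴴ * W ∧
      W * (Ahat⁻¹ * A) = diagonal (fun i => (d i : ℂ)) * W ∧
      (A * Ahat⁻¹).trace.re = ∑ i, d i ∧ (A * Ahat⁻¹).det.re = ∏ i, d i := by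
  obtain ⟨G, hG⟩ := pcg_sqrt A hA
  have hGu : IsUnit G.det := by
    have := hA.isUnit
    rw [hG, isUnit_iff_isUnit_det, det_mul] at this
    exact isUnit_of_mul_isUnit_right this
  have hH : (G * Ahat⁻¹ * Gᴴ).PosDef := by
    refine hAhat.inv.mul_mul_conjTranspose_same ?_
    exact vecMul_injective_of_isUnit ((isUnit_iff_isUnit_det G).2 hGu)
  set H := G * Ahat⁻¹ * Gᴴ with hHd
  have hsp := hH.1.spectral_theorem
  rw [Unitary.conjStarAlgAut_apply] at hsp
  set U := hH.1.eigenvectorUnitary with hU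
  set D : Matrix (Fin n) (Fin n) ℂ := diagonal (RCLike.ofReal ∘ hH.1.eigenvalues) with hD
  have hUU : star (U : Matrix (Fin n) (Fin n) ℂ) * (U : Matrix (Fin n) (Fin n) ℂ) = 1 := Unitary.coe_star_mul_self U
  have hUU' : (U : Matrix (Fin n) (Fin n) ℂ) * star (U : Matrix (Fin n) (Fin n) ℂ) = 1 := Unitary.coe_mul_star_self U
  refine ⟨star (U : Matrix (Fin n) (Fin n) ℂ) * G, hH.1.eigenvalues, hH.eigenvalues_pos, ?_, ?_, ?_, ?_⟩
  · rw [conjTranspose_mul, ← star_eq_conjTranspose (star _), star_star, Matrix.mul_assoc,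
      ← Matrix.mul_assoc (U : Matrix (Fin n) (Fin n) ℂ), hUU', Matrix.one_mul, hG]
  · change _ = D * _
    calc _ = star (U : Matrix (Fin n) (Fin n) ℂ) * H * G := by
          rw [hHd, hG]; simp only [Matrix.mul_assoc]
      _ = (star (U : Matrix (Fin n) (Fin n) ℂ) * U) * D * (star (U : Matrix (Fin n) (Fin n) ℂ) * G) := by
          rw [hsp]; simp only [Matrix.mul_assoc]
      _ = _ := by rw [hUU, Matrix.one_mul]
  · have : (A * Ahat⁻¹).trace = H.trace := by
      rw [hG, hHd, Matrix.mul_assoc, trace_mul_comm]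
    rw [this, hH.1.trace_eq_sum_eigenvalues]; simp
  · have : (A * Ahat⁻¹).det = H.det := by
      rw [hG, hHd]; simp only [det_mul]; ring
    rw [this, hH.1.det_eq_prod_eigenvalues]
    change (∏ i, ((hH.1.eigenvalues i : ℝ) : ℂ)).re = _
    rw [← Complex.ofReal_prod, Complex.ofReal_re]

theorem pcg_aeval {n : ℕ} (M W : Matrix (Fin n) (Fin n) ℂ) (d : Fin n → ℝ)
    (h : W * M = diagonal (fun i => (d i : ℂ)) * W) (p : Polynomial ℝ) :
    W * Polynomial.aeval M p = diagonal (fun i => ((p.eval (d i) : ℝ) : ℂ)) * W := by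
  induction p using Polynomial.induction_on' with
  | add p q hp hq =>
    simp only [map_add, Matrix.mul_add, hp, hq, Polynomial.eval_add, Complex.ofReal_add]
    rw [← Matrix.add_mul, diagonal_add]
  | monomial k a =>
    have : ∀ k : ℕ, W * M ^ k = diagonal (fun i => ((d i : ℂ)) ^ k) * W := by
      intro k
      induction k with
      | zero => simp
      | succ k ih =>
        rw [pow_succ, ← Matrix.mul_assoc, ih, Matrix.mul_assoc, h, ← Matrix.mul_assoc,
          diagonal_mul_diagonal]
        simp only [pow_succ]
    rw [Polynomial.aeval_monomial, ← Algebra.smul_def, Matrix.mul_smul, this]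
    ext i j
    simp [diagonal_mul, Matrix.smul_apply, mul_assoc]

theorem pcg_energy {n : ℕ} (W : Matrix (Fin n) (Fin n) ℂ) (v : Fin n → ℂ) :
    energy (Wᴴ * W) v = ∑ i, ‖(W *ᵥ v) i‖ ^ 2 := by
  unfold energy
  rw [← mulVec_mulVec, dotProduct_mulVec, ← star_mulVec, dotProduct, Complex.re_sum]
  refine Finset.sum_congr rfl fun i _ => ?_
  rw [← Complex.normSq_eq_norm_sq, Pi.star_apply, ← Complex.ofReal_re (Complex.normSq _), Complex.normSq_eq_conj_mul_self]
  rfl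

theorem pcg_exists
    (n : ℕ) (A Ahat : Matrix (Fin n) (Fin n) ℂ)
    (hA : A.PosDef) (hAhat : Ahat.PosDef)
    (κ : ℝ)
    (hκ : κ = ((1 / (n : ℝ)) * ((A * Ahat⁻¹).trace).re) ^ n /
      ((A * Ahat⁻¹).det).re)
    (b x0 : Fin n → ℂ)
    (xstar : Fin n → ℂ) (hxstar : xstar = A⁻¹ *ᵥ b)
    (r0 : Fin n → ℂ) (hr0 : r0 = b - A *ᵥ x0)
    (t : ℕ) (ht : 1 ≤ t) :
    ∃ q : Polynomial ℝ, q.degree < (t : ℕ) ∧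
      energy A
          (x0 + (Polynomial.aeval (Ahat⁻¹ * A) q) *ᵥ (Ahat⁻¹ *ᵥ r0) - xstar)
        ≤ (3 * Real.log κ / t) ^ t * energy A (x0 - xstar) := by
  obtain ⟨W, d, hd, hW, hWM, htr, hdet⟩ := pcg_diag A Ahat hA hAhat
  have hen : ∀ v, energy A v = ∑ i, ‖(W *ᵥ v) i‖ ^ 2 := fun v => by rw [hW]; exact pcg_energy W v
  have hen0 : ∀ v, 0 ≤ energy A v := fun v => by rw [hen]; positivity
  by_cases hbig : 1 ≤ 3 * Real.log κ / t
  · refine ⟨0, by simp [Polynomial.degree_zero], ?_⟩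
    simp only [map_zero, zero_mulVec, add_zero]
    exact le_mul_of_one_le_left (hen0 _) (one_le_pow₀ hbig)
  push Not at hbig
  obtain ⟨p, c, v, μ, hp, hp0, hc, hv, hμ, hb, hs, hpr⟩ :=
    pcg_poly d hd (t % 2) (by omega) (t / 2) Finset.univ
  have hprod : 0 < ∏ i, d i := Finset.prod_pos fun i _ => hd i
  have hcp : 0 < ∏ k ∈ Finset.range (t / 2), c k :=
    Finset.prod_pos fun k _ => by linarith [hc k]
  have hκ' : (∏ k ∈ Finset.range (t / 2), c k) * Real.exp v ≤ κ := by
    rw [hκ, htr, hdet, le_div_iff₀ hprod]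
    have h := pcg_amgm Finset.univ μ (fun i _ => (hμ i).le)
    rw [hpr, hs, Finset.card_univ, Fintype.card_fin] at h
    rw [one_div, ← div_eq_inv_mul]
    linarith
  have hlog := Real.log_le_log (mul_pos hcp (Real.exp_pos v)) hκ'
  rw [Real.log_mul hcp.ne' (Real.exp_pos v).ne', Real.log_exp,
    Real.log_prod (fun k _ => by linarith [hc k])] at hlog
  have hfin := pcg_final_bound (t / 2) (t % 2) t (by omega) (by omega) ht c hc v (Real.log κ) hv hlog hbig
  refine ⟨-p.divX, ?_, ?_⟩
  · rw [Polynomial.degree_neg]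
    rw [Polynomial.degree_lt_iff_coeff_zero]
    intro k hk
    rw [Polynomial.coeff_divX]
    exact Polynomial.coeff_eq_zero_of_natDegree_lt (by omega)
  · have hAu : IsUnit A.det := (isUnit_iff_isUnit_det A).1 hA.isUnit
    have hAx : A *ᵥ xstar = b := by
      rw [hxstar, mulVec_mulVec, mul_nonsing_inv _ hAu, one_mulVec]
    have hr : Ahat⁻¹ *ᵥ r0 = -((Ahat⁻¹ * A) *ᵥ (x0 - xstar)) := by
      rw [hr0, ← hAx, ← mulVec_sub, mulVec_mulVec, ← mulVec_neg, neg_sub]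
    have hpe : Polynomial.aeval (Ahat⁻¹ * A) p =
        Polynomial.aeval (Ahat⁻¹ * A) p.divX * (Ahat⁻¹ * A) + 1 := by
      conv_lhs => rw [← Polynomial.divX_mul_X_add p]
      rw [Polynomial.coeff_zero_eq_eval_zero, hp0]
      simp only [map_add, map_mul, Polynomial.aeval_X, map_one]
    have hx : x0 + (Polynomial.aeval (Ahat⁻¹ * A) (-p.divX)) *ᵥ (Ahat⁻¹ *ᵥ r0) - xstar =
        (Polynomial.aeval (Ahat⁻¹ * A) p) *ᵥ (x0 - xstar) := by
      rw [hr, hpe, map_neg, neg_mulVec_neg, mulVec_mulVec, add_mulVec, one_mulVec]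
      abel
    rw [hx, hen, hen, mulVec_mulVec, pcg_aeval _ W d hWM p, ← mulVec_mulVec, Finset.mul_sum]
    refine Finset.sum_le_sum fun i _ => ?_
    rw [mulVec_diagonal, norm_mul, mul_pow, Complex.norm_real, Real.norm_eq_abs]
    exact mul_le_mul_of_nonneg_right ((hb i (Finset.mem_univ i)).trans hfin) (by positivity)


/-- **Superlinear convergence of preconditioned conjugate gradient.**
Let `A, Â` be Hermitian positive-definite with Kaporin condition number `κ`,
`x⋆ = A⁻¹·b`, `r₀ = b − A·x₀`.  Then for every `t ≥ 1` there is a real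
polynomial `q` of degree `< t` such that
`x = x₀ + q(Â⁻¹·A)·(Â⁻¹·r₀)` satisfies
`‖x − x⋆‖_A² ≤ (3·log κ / t)ᵗ · ‖x₀ − x⋆‖_A²`.  Consequently any vector of
the affine Krylov subspace `x₀ + span{(Â⁻¹A)ʲ Â⁻¹ r₀ : j < t}` minimizing the
`A`-norm error over that subspace — in particular the `t`-th PCG iterate with
preconditioner `Â` — satisfies the same bound. -/
theorem pcg_superlinear_convergence
    (n : ℕ) (A Ahat : Matrix (Fin n) (Fin n) ℂ)
    (hA : A.PosDef) (hAhat : Ahat.PosDef)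
    (κ : ℝ)
    (hκ : κ = ((1 / (n : ℝ)) * ((A * Ahat⁻¹).trace).re) ^ n /
      ((A * Ahat⁻¹).det).re)
    (b x0 : Fin n → ℂ)
    (xstar : Fin n → ℂ) (hxstar : xstar = A⁻¹ *ᵥ b)
    (r0 : Fin n → ℂ) (hr0 : r0 = b - A *ᵥ x0)
    (t : ℕ) (ht : 1 ≤ t) :
    (∃ q : Polynomial ℝ, q.degree < (t : ℕ) ∧
      energy A
          (x0 + (Polynomial.aeval (Ahat⁻¹ * A) q) *ᵥ (Ahat⁻¹ *ᵥ r0) - xstar)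
        ≤ (3 * Real.log κ / t) ^ t * energy A (x0 - xstar)) ∧
    (∀ xt : Fin n → ℂ,
      (∃ q : Polynomial ℝ, q.degree < (t : ℕ) ∧
          xt = x0 + (Polynomial.aeval (Ahat⁻¹ * A) q) *ᵥ (Ahat⁻¹ *ᵥ r0)) →
      (∀ q : Polynomial ℝ, q.degree < (t : ℕ) →
          energy A (xt - xstar) ≤
            energy A (x0 + (Polynomial.aeval (Ahat⁻¹ * A) q) *ᵥ
              (Ahat⁻¹ *ᵥ r0) - xstar)) →
      energy A (xt - xstar)
        ≤ (3 * Real.log κ / t) ^ t * energy A (x0 - xstar)) := by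
  have h := pcg_exists n A Ahat hA hAhat κ hκ b x0 xstar hxstar r0 hr0 t ht
  refine ⟨h, fun xt _ hmin => ?_⟩
  obtain ⟨q, hq, hle⟩ := h
  exact (hmin q hq).trans hle
end

section
/- Let r ≥ 1 and let λ₁, …, λ_r be strictly positive real numbers, and set κ = ((1/r)·∑_i λ_i)ʳ / ∏_i λ_i (a real number ≥ 1). Then for every integer t ≥ 1 there exists a polynomial p over ℝ of degree ≤ t with p(0) = 1 such that (p(λ_i))² ≤ (3·log(κ)/t)ᵗ for every i = 1, …, r. -/
open Finset in
theorem kap_mahler (s : ℕ) (hs : 1 ≤ s) (q : ℕ → ℝ) (hq : ∀ j ∈ range s, 1 ≤ q j) :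
    ∏ j ∈ range s, (q j - 1) ≤ (Real.exp ((∑ j ∈ range s, Real.log (q j)) / s) - 1) ^ s := by
  have hs0 : (0 : ℝ) < s := by exact_mod_cast hs
  have hq0 : ∀ j ∈ range s, 0 < q j := fun j hj => lt_of_lt_of_le one_pos (hq j hj)
  set g := Real.exp ((∑ j ∈ range s, Real.log (q j)) / s) with hg
  have hgs : g ^ s = ∏ j ∈ range s, q j := by
    rw [hg, ← Real.exp_nat_mul, mul_div_cancel₀ _ hs0.ne', Real.exp_sum]
    exact prod_congr rfl fun j hj => Real.exp_log (hq0 j hj)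
  have hgpos : 0 < g := Real.exp_pos _
  have amgm : ∀ z : ℕ → ℝ, (∀ j ∈ range s, 0 ≤ z j) →
      ∏ j ∈ range s, z j ≤ ((∑ j ∈ range s, z j) / s) ^ s := by
    intro z hz
    have h := Real.geom_mean_le_arith_mean (range s) (fun _ => (1 : ℝ)) z (fun _ _ => zero_le_one)
      (by simpa using hs0) hz
    simp only [Real.rpow_one, one_mul, sum_const, card_range, nsmul_eq_mul, mul_one] at h
    have h0 : 0 ≤ ∏ j ∈ range s, z j := prod_nonneg hz
    have h' := pow_le_pow_left₀ (Real.rpow_nonneg h0 _) h s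
    rwa [Real.rpow_inv_natCast_pow h0 (by omega)] at h'
  have h1 := amgm (fun j => 1 - (q j)⁻¹) (fun j hj => by
    have := inv_le_one_of_one_le₀ (hq j hj); linarith)
  have h2 := amgm (fun j => (q j)⁻¹) (fun j hj => (inv_pos.2 (hq0 j hj)).le)
  have hm0 : 0 ≤ (∑ j ∈ range s, (q j)⁻¹) / s :=
    div_nonneg (sum_nonneg fun j hj => (inv_pos.2 (hq0 j hj)).le) hs0.le
  set m := (∑ j ∈ range s, (q j)⁻¹) / s with hm
  have e1 : (∑ j ∈ range s, (1 - (q j)⁻¹)) / s = 1 - m := by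
    rw [sum_sub_distrib, hm]; simp; field_simp
  rw [e1] at h1
  have hgm : g⁻¹ ≤ m := by
    rw [prod_inv_distrib, ← hgs, ← inv_pow] at h2
    exact le_of_pow_le_pow_left₀ (by omega) hm0 h2
  have hm1 : m ≤ 1 := by
    rw [hm, div_le_one hs0]
    calc _ ≤ ∑ j ∈ range s, (1 : ℝ) := sum_le_sum fun j hj => inv_le_one_of_one_le₀ (hq j hj)
      _ = s := by simp
  calc ∏ j ∈ range s, (q j - 1) = ∏ j ∈ range s, (q j * (1 - (q j)⁻¹)) := by
        refine prod_congr rfl fun j hj => ?_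
        have := (hq0 j hj).ne'
        field_simp
    _ = g ^ s * ∏ j ∈ range s, (1 - (q j)⁻¹) := by rw [prod_mul_distrib, hgs]
    _ ≤ g ^ s * (1 - m) ^ s := by gcongr
    _ ≤ g ^ s * (1 - g⁻¹) ^ s := by
        have : 0 ≤ 1 - m := by linarith
        gcongr
    _ = (g - 1) ^ s := by rw [← mul_pow]; congr 1; field_simp

theorem kap_exp1 (y : ℝ) (h0 : 0 ≤ y) (h1 : y ≤ 3 / 4) : Real.exp y - 1 ≤ 3 / 2 * y := by
  have h := Real.exp_bound' h0 (by linarith) (n := 4) (by norm_num)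
  norm_num [Finset.sum_range_succ, Nat.factorial] at h
  have h2 : y ^ 2 ≤ 3 / 4 * y := by nlinarith
  have h3 : y ^ 3 ≤ 3 / 4 * y ^ 2 := by nlinarith [sq_nonneg y]
  have h4 : y ^ 4 ≤ 3 / 4 * y ^ 3 := by nlinarith [pow_nonneg h0 3]
  linarith

theorem kap_exp2 (y : ℝ) (h0 : 0 ≤ y) (h1 : y ≤ 1) : Real.exp y - 1 ≤ 7 / 4 * y := by
  have h := Real.exp_bound' h0 h1 (n := 4) (by norm_num)
  norm_num [Finset.sum_range_succ, Nat.factorial] at h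
  have h2 : y ^ 2 ≤ y := by nlinarith
  have h3 : y ^ 3 ≤ y ^ 2 := by nlinarith [sq_nonneg y]
  have h4 : y ^ 4 ≤ y ^ 3 := by nlinarith [pow_nonneg h0 3]
  linarith

theorem kap_amgm (n : ℕ) (hn : n ≠ 0) (x d : ℝ) (hx : 0 ≤ x) (hd : 0 ≤ d) :
    x ^ n * d ≤ ((n * x + d) / (n + 1)) ^ (n + 1) := by
  rcases hx.eq_or_lt with rfl | hx
  · rw [zero_pow hn, zero_mul]; positivity
  have hn1 : (0 : ℝ) < n + 1 := by positivity
  have hb := one_add_mul_le_pow (a := (n * x + d) / (n + 1) / x - 1) (by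
    have : 0 ≤ (n * x + d) / (n + 1) / x := by positivity
    linarith) (n + 1)
  have e : 1 + ((n + 1 : ℕ) : ℝ) * ((n * x + d) / (n + 1) / x - 1) = d / x := by
    push_cast; field_simp; ring
  rw [e, add_sub_cancel, div_pow, le_div_iff₀ (by positivity)] at hb
  calc x ^ n * d = d / x * x ^ (n + 1) := by field_simp; ring
    _ ≤ _ := hb

theorem kap_odd (s : ℕ) (S L D P : ℝ) (hS : 0 ≤ S) (hD : 0 ≤ D) (hSD : S + D ≤ L)
    (hL : 3 * L < 2 * s + 1) (hP0 : 0 ≤ P) (hP1 : s = 0 → P = 1)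
    (hP : 1 ≤ s → P ≤ (Real.exp (S / s) - 1) ^ s) :
    P ^ 2 * D ≤ (3 * L / ((2 * s + 1 : ℕ) : ℝ)) ^ (2 * s + 1) := by
  rcases Nat.eq_zero_or_pos s with rfl | hs
  · rw [hP1 rfl]; norm_num; linarith
  have hs0 : (0 : ℝ) < s := by exact_mod_cast hs
  have hs1 : (1 : ℝ) ≤ s := by exact_mod_cast hs
  have hL0 : 0 ≤ L := by linarith
  have hy0 : 0 ≤ S / s := by positivity
  obtain ⟨c, hc0, hc, hcs⟩ : ∃ c : ℝ, 0 ≤ c ∧ Real.exp (S / s) - 1 ≤ c * (S / s) ∧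
      (2 * c) ^ (2 * s) ≤ 3 ^ (2 * s + 1) := by
    rcases Nat.lt_or_ge s 4 with h4 | h4
    · refine ⟨7 / 4, by norm_num, kap_exp2 _ hy0 ?_, ?_⟩
      · rw [div_le_one hs0]; linarith
      · interval_cases s <;> norm_num
    · have h4' : (4 : ℝ) ≤ s := by exact_mod_cast h4
      refine ⟨3 / 2, by norm_num, kap_exp1 _ hy0 ?_, ?_⟩
      · rw [div_le_iff₀ hs0]; linarith
      · norm_num
        exact pow_le_pow_right₀ (by norm_num) (by omega)
  have hPc : P ≤ (c * (S / s)) ^ s := (hP hs).trans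
    (pow_le_pow_left₀ (by linarith [Real.add_one_le_exp (S / s)]) hc s)
  have ham := kap_amgm (2 * s) (by omega) (S / (2 * s)) D (by positivity) hD
  have e2 : (((2 * s : ℕ) : ℝ) * (S / (2 * s)) + D) = S + D := by
    push_cast; field_simp
  rw [e2] at ham
  calc P ^ 2 * D ≤ ((c * (S / s)) ^ s) ^ 2 * D := by gcongr
    _ = (2 * c) ^ (2 * s) * ((S / (2 * s)) ^ (2 * s) * D) := by
        rw [← mul_assoc, ← mul_pow, ← pow_mul, mul_comm s 2]
        congr 2; field_simp
    _ ≤ 3 ^ (2 * s + 1) * ((S + D) / (((2 * s : ℕ) : ℝ) + 1)) ^ (2 * s + 1) := by gcongr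
    _ ≤ 3 ^ (2 * s + 1) * (L / (((2 * s : ℕ) : ℝ) + 1)) ^ (2 * s + 1) := by gcongr
    _ = _ := by rw [← mul_pow]; push_cast; congr 1; ring

theorem kap_even (s : ℕ) (hs : 1 ≤ s) (S L P : ℝ) (hS : 0 ≤ S) (hSD : S ≤ L)
    (hL : 3 * L < 2 * s) (hP0 : 0 ≤ P)
    (hP : P ≤ (Real.exp (S / s) - 1) ^ s) :
    P ^ 2 ≤ (3 * L / ((2 * s : ℕ) : ℝ)) ^ (2 * s) := by
  have hs0 : (0 : ℝ) < s := by exact_mod_cast hs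
  have hy0 : 0 ≤ S / s := by positivity
  have hc := kap_exp1 _ hy0 (by rw [div_le_iff₀ hs0]; linarith)
  have hPc : P ≤ (3 / 2 * (S / s)) ^ s := hP.trans
    (pow_le_pow_left₀ (by linarith [Real.add_one_le_exp (S / s)]) hc s)
  calc P ^ 2 ≤ ((3 / 2 * (S / s)) ^ s) ^ 2 := by gcongr
    _ = (3 / 2 * (S / s)) ^ (2 * s) := by rw [← pow_mul, mul_comm s 2]
    _ ≤ (3 / 2 * (L / s)) ^ (2 * s) := by gcongr
    _ = _ := by push_cast; congr 1; field_simp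

/-- the ratio of a pair -/
noncomputable def kapQ (a b : ℝ) : ℝ := (a + b) ^ 2 / (4 * a * b)

theorem kapQ_ge (a b : ℝ) (ha : 0 < a) (hb : 0 < b) : 1 ≤ kapQ a b := by
  unfold kapQ
  rw [le_div_iff₀ (by positivity)]; nlinarith [sq_nonneg (a - b)]

theorem kap_pair (a b x : ℝ) (ha : 0 < a) (hax : a ≤ x) (hxb : x ≤ b) :
    |(1 - a⁻¹ * x) * (1 - b⁻¹ * x)| ≤ kapQ a b - 1 := by
  have hb : 0 < b := by linarith
  have e : (1 - a⁻¹ * x) * (1 - b⁻¹ * x) = -((x - a) * (b - x) / (a * b)) := by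
    field_simp; ring
  have e2 : kapQ a b - 1 = ((b - a) ^ 2 / 4) / (a * b) := by
    unfold kapQ; field_simp; ring
  rw [e, abs_neg, abs_of_nonneg (div_nonneg (mul_nonneg (by linarith) (by linarith)) (by positivity)), e2]
  gcongr
  nlinarith [sq_nonneg (x - a - (b - x))]

theorem kap_mid (a b x : ℝ) (ha : 0 < a) (hax : a ≤ x) (hxb : x ≤ b) :
    (1 - (2 / (a + b)) * x) ^ 2 ≤ Real.log (kapQ a b) := by
  have hb : 0 < b := by linarith
  have h := Real.one_sub_inv_le_log_of_pos (lt_of_lt_of_le one_pos (kapQ_ge a b ha hb))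
  refine le_trans ?_ h
  have e : (1 - (2 / (a + b)) * x) ^ 2 = (a + b - 2 * x) ^ 2 / (a + b) ^ 2 := by
    field_simp
  have e2 : 1 - (kapQ a b)⁻¹ = (b - a) ^ 2 / (a + b) ^ 2 := by
    unfold kapQ; field_simp; ring
  rw [e, e2]
  gcongr ?_ / _
  nlinarith [mul_nonneg (sub_nonneg.2 hax) (sub_nonneg.2 hxb)]

theorem kap_logpair (a b M : ℝ) (ha : 0 < a) (hb : 0 < b) (hM : 0 < M) :
    Real.log (kapQ a b) ≤ (a / M - 1 - Real.log (a / M)) + (b / M - 1 - Real.log (b / M)) := by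
  have h := Real.log_le_sub_one_of_pos (show 0 < (a + b) / (2 * M) by positivity)
  have e : kapQ a b = ((a + b) / (2 * M)) ^ 2 / ((a / M) * (b / M)) := by
    unfold kapQ; field_simp; ring
  rw [e, Real.log_div (by positivity) (by positivity), Real.log_pow,
    Real.log_mul (by positivity) (by positivity)]
  have e3 : (a + b) / (2 * M) = (a / M + b / M) / 2 := by field_simp
  push_cast
  linarith

open Finset in
theorem kap_sum_pairs (r m : ℕ) (h : 2 * m ≤ r) (G : ℕ → ℝ) (hG : ∀ i < r, 0 ≤ G i) :
    ∑ j ∈ range m, (G j + G (r - 1 - j)) ≤ ∑ i ∈ range r, G i := by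
  induction m with
  | zero =>
    have h0 : 0 ≤ ∑ i ∈ range r, G i := sum_nonneg fun i hi => hG i (mem_range.1 hi)
    simpa using h0
  | succ m ih =>
    clear ih
    rw [sum_add_distrib]
    have : ∑ j ∈ range (m+1), G (r - 1 - j) = ∑ i ∈ Ico (r - (m+1)) r, G i := by
      refine sum_nbij' (fun j => r - 1 - j) (fun j => r - 1 - j) ?_ ?_ ?_ ?_ ?_ <;>
        intro j hj <;> simp at hj ⊢ <;> omega
    rw [this, ← sum_range_add_sum_Ico G (show r - (m + 1) ≤ r by omega)]
    refine add_le_add_left (sum_le_sum_of_subset_of_nonneg ?_ ?_) _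
    · intro i; simp; omega
    · intro i hi _; simp at hi; exact hG i (by omega)

open Finset in
theorem kap_log (r : ℕ) (hr : 1 ≤ r) (l : ℕ → ℝ) (hl : ∀ i < r, 0 < l i)
    (κ : ℝ) (hκ : κ = ((1 / (r : ℝ)) * ∑ i ∈ range r, l i) ^ r / ∏ i ∈ range r, l i)
    (m : ℕ) (hm : 2 * m ≤ r) :
    ∑ j ∈ range m, Real.log (kapQ (l j) (l (r - 1 - j))) ≤ Real.log κ := by
  have hr0 : (0 : ℝ) < r := by exact_mod_cast hr
  have hsum : 0 < ∑ i ∈ range r, l i :=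
    sum_pos (fun i hi => hl i (mem_range.1 hi)) ⟨0, by simp; omega⟩
  set M := (1 / (r : ℝ)) * ∑ i ∈ range r, l i with hMdef
  have hM : 0 < M := by positivity
  have hL : Real.log κ = ∑ i ∈ range r, (l i / M - 1 - Real.log (l i / M)) := by
    rw [hκ, Real.log_div (by positivity) (prod_pos fun i hi => hl i (mem_range.1 hi)).ne',
      Real.log_pow, Real.log_prod (fun i hi => (hl i (mem_range.1 hi)).ne')]
    have : ∀ i ∈ range r, (l i / M - 1 - Real.log (l i / M)) =
        l i / M - 1 - (Real.log (l i) - Real.log M) := fun i hi => by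
      rw [Real.log_div (hl i (mem_range.1 hi)).ne' hM.ne']
    rw [sum_congr rfl this, sum_sub_distrib, sum_sub_distrib, sum_sub_distrib, ← sum_div]
    have e : (∑ i ∈ range r, l i) / M = r := by
      rw [hMdef]; field_simp
    rw [e]; simp
  rw [hL]
  refine le_trans (sum_le_sum fun j hj => ?_) (kap_sum_pairs r m hm _ ?_)
  · have := mem_range.1 hj
    exact kap_logpair _ _ M (hl _ (by omega)) (hl _ (by omega)) hM
  · intro i hi
    linarith [Real.log_le_sub_one_of_pos (div_pos (hl i hi) hM)]

open Finset Polynomial in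
theorem kap_nat (r : ℕ) (hr : 1 ≤ r) (l : ℕ → ℝ) (hl : ∀ i < r, 0 < l i)
    (hmono : ∀ i j, i ≤ j → j < r → l i ≤ l j)
    (κ : ℝ) (hκ : κ = ((1 / (r : ℝ)) * ∑ i ∈ range r, l i) ^ r / ∏ i ∈ range r, l i)
    (t : ℕ) (ht : 1 ≤ t) :
    ∃ p : Polynomial ℝ, p.natDegree ≤ t ∧ p.eval 0 = 1 ∧
      ∀ i < r, (p.eval (l i)) ^ 2 ≤ (3 * Real.log κ / t) ^ t := by
  have ht0 : (0 : ℝ) < t := by exact_mod_cast ht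
  have hlog := kap_log r hr l hl κ hκ
  have hL0 : 0 ≤ Real.log κ := by simpa using hlog 0 (by omega)
  have hlin : ∀ c : ℝ, (1 - C c * X : ℝ[X]).natDegree ≤ 1 := fun c => by compute_degree
  by_cases hbig : (t : ℝ) ≤ 3 * Real.log κ
  · refine ⟨1, by simp, by simp, fun i hi => ?_⟩
    simp only [eval_one, one_pow]
    exact one_le_pow₀ (by rwa [one_le_div ht0])
  push Not at hbig
  have hR0 : 0 ≤ (3 * Real.log κ / t) ^ t := by positivity
  rcases Nat.lt_or_ge t r with htr | htr
  swap
  · refine ⟨∏ j ∈ range r, (1 - C (l j)⁻¹ * X), ?_, ?_, ?_⟩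
    · refine (natDegree_prod_le _ _).trans ((sum_le_sum fun j _ => hlin _).trans ?_)
      simpa using htr
    · simp [eval_prod]
    · intro i hi
      have : eval (l i) (∏ j ∈ range r, (1 - C (l j)⁻¹ * X)) = 0 := by
        rw [eval_prod]
        refine prod_eq_zero (mem_range.2 hi) ?_
        simp [(hl i hi).ne']
      rw [this]; simpa using hR0
  -- the base polynomial
  have base : ∀ s : ℕ, 2 * s < r → ∃ p : ℝ[X], p.natDegree ≤ 2 * s ∧ p.eval 0 = 1 ∧
      ∀ i < r, p.eval (l i) = 0 ∨ (s ≤ i ∧ i ≤ r - 1 - s ∧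
        |p.eval (l i)| ≤ ∏ j ∈ range s, (kapQ (l j) (l (r - 1 - j)) - 1)) := by
    intro s hs
    refine ⟨∏ j ∈ range s, ((1 - C (l j)⁻¹ * X) * (1 - C (l (r - 1 - j))⁻¹ * X)), ?_, ?_, ?_⟩
    · refine (natDegree_prod_le _ _).trans ((sum_le_sum fun j _ =>
        natDegree_mul_le.trans (add_le_add (hlin _) (hlin _))).trans ?_)
      simp [mul_comm]
    · simp [eval_prod]
    · intro i hi
      rcases Nat.lt_or_ge i s with h1 | h1
      · left
        rw [eval_prod]
        refine prod_eq_zero (mem_range.2 h1) ?_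
        simp [(hl i hi).ne']
      rcases Nat.lt_or_ge (r - 1 - s) i with h2 | h2
      · left
        rw [eval_prod]
        refine prod_eq_zero (i := r - 1 - i) (mem_range.2 (by omega)) ?_
        have : r - 1 - (r - 1 - i) = i := by omega
        simp [this, (hl i hi).ne']
      right
      refine ⟨h1, h2, ?_⟩
      rw [eval_prod, abs_prod]
      refine prod_le_prod (fun _ _ => abs_nonneg _) fun j hj => ?_
      have hj' := mem_range.1 hj
      have := kap_pair (l j) (l (r - 1 - j)) (l i) (hl j (by omega))
        (hmono _ _ (by omega) hi) (hmono _ _ (by omega) (by omega))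
      simpa using this
  have hQ : ∀ j, 2 * j < r → 1 ≤ kapQ (l j) (l (r - 1 - j)) := fun j hj =>
    kapQ_ge _ _ (hl _ (by omega)) (hl _ (by omega))
  have hmah : ∀ s : ℕ, 2 * s < r → 1 ≤ s → _ := fun s hs h1 =>
    kap_mahler s h1 (fun j => kapQ (l j) (l (r - 1 - j)))
      (fun j hj => hQ j (by have := mem_range.1 hj; omega))
  have hP0 : ∀ s : ℕ, 2 * s < r → 0 ≤ ∏ j ∈ range s, (kapQ (l j) (l (r - 1 - j)) - 1) :=
    fun s hs => prod_nonneg fun j hj =>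
      sub_nonneg.2 (hQ j (by have := mem_range.1 hj; omega))
  have hS0 : ∀ s : ℕ, 2 * s < r → 0 ≤ ∑ j ∈ range s, Real.log (kapQ (l j) (l (r - 1 - j))) :=
    fun s hs => sum_nonneg fun j hj =>
      Real.log_nonneg (hQ j (by have := mem_range.1 hj; omega))
  rcases Nat.even_or_odd' t with ⟨s, rfl | rfl⟩
  · obtain ⟨p, hpd, hp0, hp⟩ := base s htr
    refine ⟨p, hpd, hp0, fun i hi => ?_⟩
    rcases hp i hi with h | ⟨_, _, h⟩
    · rw [h]; simpa using hR0
    · rw [← sq_abs]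
      refine (pow_le_pow_left₀ (abs_nonneg _) h 2).trans ?_
      exact kap_even s (by omega) _ _ _ (hS0 s htr) (hlog s htr.le)
        (by push_cast at hbig; linarith) (hP0 s htr) (hmah s htr (by omega))
  · have hs : 2 * s < r := by omega
    obtain ⟨p, hpd, hp0, hp⟩ := base s hs
    refine ⟨p * (1 - C (2 / (l s + l (r - 1 - s))) * X),
      natDegree_mul_le.trans (add_le_add hpd (hlin _)), by simp [hp0], fun i hi => ?_⟩
    rcases hp i hi with h | ⟨hi1, hi2, h⟩
    · rw [eval_mul, h, zero_mul]; simpa using hR0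
    · rw [eval_mul, mul_pow, ← sq_abs (eval (l i) p)]
      have hmid := kap_mid (l s) (l (r - 1 - s)) (l i) (hl _ (by omega))
        (hmono _ _ hi1 hi) (hmono _ _ hi2 (by omega))
      have h2 : (eval (l i) (1 - C (2 / (l s + l (r - 1 - s))) * X)) ^ 2 ≤
          Real.log (kapQ (l s) (l (r - 1 - s))) := by simpa using hmid
      refine (mul_le_mul (pow_le_pow_left₀ (abs_nonneg _) h 2) h2 (sq_nonneg _)
        (sq_nonneg _)).trans ?_
      have hlg := hlog (s + 1) (by omega)
      rw [sum_range_succ] at hlg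
      exact kap_odd s _ _ _ _ (hS0 s hs) (Real.log_nonneg (hQ s hs)) hlg
        (by push_cast at hbig; linarith) (hP0 s hs) (by rintro rfl; simp)
        (hmah s hs)

/-- **Polynomial approximation at the heart of PCG superlinear convergence.**
For strictly positive `λ₁, …, λ_r` with Kaporin-type ratio
`κ = ((1/r)·∑ λᵢ)ʳ / ∏ λᵢ ≥ 1`, and every `t ≥ 1`, there exists a real
polynomial `p` of degree `≤ t` with `p(0) = 1` such that
`p(λᵢ)² ≤ (3·log κ / t)ᵗ` for every `i`. -/
theorem exists_polynomial_kaporin_bound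
    (r : ℕ) (hr : 1 ≤ r) (lam : Fin r → ℝ) (hpos : ∀ i, 0 < lam i)
    (κ : ℝ) (hκ : κ = ((1 / (r : ℝ)) * ∑ i, lam i) ^ r / ∏ i, lam i)
    (t : ℕ) (ht : 1 ≤ t) :
    ∃ p : Polynomial ℝ, p.natDegree ≤ t ∧ p.eval 0 = 1 ∧
      ∀ i, (p.eval (lam i)) ^ 2 ≤ (3 * Real.log κ / t) ^ t := by
  have hσ := Tuple.monotone_sort lam
  set σ := Tuple.sort lam with hσd
  have key : ∀ i : Fin r, (fun n => if h : n < r then lam (σ ⟨n, h⟩) else 1) (i : ℕ) = lam (σ i) := by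
    intro i; simp
  obtain ⟨p, h1, h2, h3⟩ := kap_nat r hr (fun n => if h : n < r then lam (σ ⟨n, h⟩) else 1)
    (fun i hi => by simp only [hi, dif_pos]; exact hpos _)
    (fun i j hij hj => by
      have hi : i < r := by omega
      simp only [hi, hj, dif_pos]
      exact hσ (show (⟨i, hi⟩ : Fin r) ≤ ⟨j, hj⟩ from hij))
    κ (by
      rw [← Fin.sum_univ_eq_sum_range, ← Fin.prod_univ_eq_prod_range]
      simp only [key]
      rw [Equiv.sum_comp σ lam, Equiv.prod_comp σ lam]
      exact hκ) t ht
  refine ⟨p, h1, h2, fun i => ?_⟩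
  have := h3 (σ.symm i) (Fin.is_lt _)
  simpa using this
end

section
/- Let A ∈ ℂ^{n×n} be Hermitian positive-definite, let S_i ⊆ {1,…,i−1} for i = 1,…,n, and let Ĉ be a unit lower triangular matrix with Ĉ(i,j) = 0 for all j ∉ S_i ∪ {i} such that (Ĉ·A)(i,j) = 0 for every i and every j ∈ S_i. Let D̂ be the diagonal matrix with D̂(i,i) = (Ĉ·A·Ĉ*)(i,i). Then for every i, D̂(i,i) = (Ĉ·A)(i,i) and D̂(i,i) > 0, and the Vecchia approximation Â = Ĉ⁻¹·D̂·Ĉ⁻* satisfies the trace normalization tr(A·Â⁻¹) = n. -/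
open Matrix
open scoped ComplexOrder

/-- **Trace normalization of the Vecchia approximation.**
Let `A` be Hermitian positive-definite and let `Ĉ` be a unit lower triangular
matrix with sparsity pattern `S i ⊆ {0,…,i-1}` such that `(Ĉ·A)(i,j) = 0` for
every `j ∈ S i`, and let `D̂(i,i) = (Ĉ·A·Ĉᴴ)(i,i)`.  Then
`D̂(i,i) = (Ĉ·A)(i,i)` is a strictly positive real, and the Vecchia
approximation `Â = Ĉ⁻¹·D̂·Ĉ⁻ᴴ` satisfies `tr(A·Â⁻¹) = n`. -/
theorem vecchia_trace_normalization
    (n : ℕ) (A : Matrix (Fin n) (Fin n) ℂ) (hA : A.PosDef)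
    (S : Fin n → Finset (Fin n)) (hS : ∀ i : Fin n, ∀ j ∈ S i, j < i)
    (Chat : Matrix (Fin n) (Fin n) ℂ) (hChat : UnitLowerTri Chat)
    (hsparse : ∀ i j : Fin n, i ≠ j → j ∉ S i → Chat i j = 0)
    (hann : ∀ i : Fin n, ∀ j ∈ S i, (Chat * A) i j = 0)
    (Dhat : Matrix (Fin n) (Fin n) ℂ)
    (hDhat : Dhat = Matrix.diagonal (fun i => (Chat * A * Chatᴴ) i i)) :
    (∀ i : Fin n, Dhat i i = (Chat * A) i i ∧
      0 < ((Chat * A * Chatᴴ) i i).re ∧ ((Chat * A * Chatᴴ) i i).im = 0) ∧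
    (A * (Chat⁻¹ * Dhat * (Chat⁻¹)ᴴ)⁻¹).trace = (n : ℂ) := by
  obtain ⟨hd, hu⟩ := hChat
  have hdet : Chat.det = 1 := by
    rw [Matrix.det_of_lowerTriangular Chat (fun i j h => hu i j (by simpa using h))]
    simp [hd]
  have hunit : IsUnit Chat := by
    rw [Matrix.isUnit_iff_isUnit_det, hdet]; exact isUnit_one
  have hpd : (Chat * A * Chatᴴ).PosDef :=
    hA.mul_mul_conjTranspose_same (Matrix.vecMul_injective_iff_isUnit.2 hunit)
  have hpos : ∀ i, 0 < (Chat * A * Chatᴴ) i i := fun i => hpd.diag_pos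
  have hdiag : ∀ i, (Chat * A * Chatᴴ) i i = (Chat * A) i i := by
    intro i
    rw [Matrix.mul_apply, Finset.sum_eq_single i]
    · simp [Matrix.conjTranspose_apply, hd]
    · intro j _ hj
      by_cases h : j ∈ S i
      · rw [hann i j h, zero_mul]
      · simp [Matrix.conjTranspose_apply, hsparse i j hj.symm h]
    · simp
  refine ⟨fun i => ⟨?_, ?_, ?_⟩, ?_⟩
  · rw [hDhat, Matrix.diagonal_apply_eq, hdiag]
  · exact (Complex.pos_iff.1 (hpos i)).1
  · exact (Complex.pos_iff.1 (hpos i)).2.symm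
  have hdu : IsUnit Chat.det := by rw [hdet]; exact isUnit_one
  have hinv : Dhat⁻¹ = Matrix.diagonal (fun i => ((Chat * A * Chatᴴ) i i)⁻¹) := by
    apply Matrix.inv_eq_left_inv
    rw [hDhat, Matrix.diagonal_mul_diagonal, ← Matrix.diagonal_one]
    congr 1
    funext i
    exact inv_mul_cancel₀ (hpos i).ne'
  rw [Matrix.mul_inv_rev, Matrix.mul_inv_rev, ← Matrix.conjTranspose_nonsing_inv,
    Matrix.nonsing_inv_nonsing_inv _ hdu, hinv, ← Matrix.mul_assoc, ← Matrix.mul_assoc, Matrix.trace_mul_comm,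
    ← Matrix.mul_assoc, ← Matrix.mul_assoc]
  simp only [Matrix.trace, Matrix.diag_apply, Matrix.mul_diagonal]
  rw [Finset.sum_congr rfl (fun i _ => mul_inv_cancel₀ (hpos i).ne')]
  simp
end

section
/- Let A ∈ ℂ^{n×n} be Hermitian positive-definite, let S_i ⊆ {1,…,i−1} for i = 1,…,n, and let Ĉ be a unit lower triangular matrix with Ĉ(i,j) = 0 for all j ∉ S_i ∪ {i} such that (Ĉ·A)(i,j) = 0 for every i and every j ∈ S_i. Let D̂ be the diagonal matrix with D̂(i,i) = (Ĉ·A·Ĉ*)(i,i). Then det(Â) ≥ det(A), where Â = Ĉ⁻¹·D̂·Ĉ⁻*; equivalently, ∏_{i=1}^{n} D̂(i,i) ≥ det(A), so the determinant of the Vecchia approximation is an upper bound for the determinant of A. -/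
open Matrix
open scoped ComplexOrder

lemma hadamard_unit {n : ℕ} (M : Matrix (Fin n) (Fin n) ℂ) (hM : M.PosDef)
    (h1 : ∀ i, M i i = 1) : M.det.re ≤ 1 := by
  have ht : ∑ i, hM.1.eigenvalues i = n := by
    have h := hM.1.trace_eq_sum_eigenvalues
    simp only [Matrix.trace, Matrix.diag, h1] at h
    have h2 := congrArg Complex.re h
    simpa using h2.symm
  have hd : M.det.re = ∏ i, hM.1.eigenvalues i := by
    rw [hM.1.det_eq_prod_eigenvalues]
    have : (∏ i, ((hM.1.eigenvalues i : ℝ) : ℂ)) = ((∏ i, hM.1.eigenvalues i : ℝ) : ℂ) := by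
      push_cast; rfl
    exact (congrArg Complex.re this).trans (Complex.ofReal_re _)
  rw [hd]
  calc ∏ i, hM.1.eigenvalues i ≤ ∏ i, Real.exp (hM.1.eigenvalues i - 1) :=
        Finset.prod_le_prod (fun i _ => (hM.eigenvalues_pos i).le)
          (fun i _ => by linarith [Real.add_one_le_exp (hM.1.eigenvalues i - 1)])
    _ = 1 := by
        rw [← Real.exp_sum, Finset.sum_sub_distrib, ht]; simp

lemma hadamard_posDef {n : ℕ} (B : Matrix (Fin n) (Fin n) ℂ) (hB : B.PosDef) :
    B.det.re ≤ (∏ i, B i i).re := by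
  have hpos : ∀ i, 0 < (B i i).re := fun i => (Complex.pos_iff.1 (hB.diag_pos (i := i))).1
  have him : ∀ i, B i i = (((B i i).re : ℝ) : ℂ) := fun i =>
    Complex.ext (by simp) (by simpa using (Complex.pos_iff.1 (hB.diag_pos (i := i))).2.symm)
  set b : Fin n → ℝ := fun i => (B i i).re with hb
  set d : Fin n → ℝ := fun i => (Real.sqrt (b i))⁻¹ with hd
  have hdpos : ∀ i, 0 < d i := fun i => inv_pos.2 (Real.sqrt_pos.2 (hpos i))
  have hdd : ∀ i, d i * b i * d i = 1 := fun i => by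
    have h := Real.mul_self_sqrt (hpos i).le
    have h2 := (Real.sqrt_pos.2 (hpos i)).ne'
    simp only [hd, hb]
    field_simp
    nlinarith
  set E : Matrix (Fin n) (Fin n) ℂ := Matrix.diagonal (fun i => (d i : ℂ)) with hE
  have hEH : Eᴴ = E := by
    rw [hE, Matrix.diagonal_conjTranspose]; congr 1; ext i; simp
  have hEdet : E.det = ((∏ i, d i : ℝ) : ℂ) := by
    rw [hE, Matrix.det_diagonal]; push_cast; rfl
  have hEu : IsUnit E := by
    rw [Matrix.isUnit_iff_isUnit_det, hEdet, isUnit_iff_ne_zero]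
    exact_mod_cast (Finset.prod_pos fun i _ => hdpos i).ne'
  have hM : (E * B * Eᴴ).PosDef := (Matrix.IsUnit.posDef_star_right_conjugate_iff hEu).2 hB
  have h := hadamard_unit _ hM (fun i => by
    rw [hEH, hE, Matrix.mul_diagonal, Matrix.diagonal_mul, him i]
    exact_mod_cast hdd i)
  rw [hEH, Matrix.det_mul, Matrix.det_mul, hEdet, mul_comm, ← mul_assoc, ← Complex.ofReal_mul,
    Complex.re_ofReal_mul] at h
  have hp : (∏ i, B i i).re = ∏ i, b i := by
    rw [Finset.prod_congr rfl (fun i _ => him i), ← Complex.ofReal_prod, Complex.ofReal_re]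
  have hone : (∏ i, d i) * (∏ i, d i) * ∏ i, b i = 1 := by
    rw [← Finset.prod_mul_distrib, ← Finset.prod_mul_distrib]
    exact Finset.prod_eq_one fun i _ => by rw [← hdd i]; ring
  have hq : 0 < (∏ i, d i) * (∏ i, d i) := by
    have := Finset.prod_pos fun i (_ : i ∈ Finset.univ) => hdpos i
    positivity
  rw [hp]
  rw [← hone] at h
  exact le_of_mul_le_mul_left h hq

/-- **The Vecchia determinant upper-bounds the true determinant.**
Let `A` be Hermitian positive-definite and let `Ĉ` be a unit lower triangular
matrix with sparsity pattern `S i ⊆ {0,…,i-1}` such that `(Ĉ·A)(i,j) = 0` for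
every `j ∈ S i`, and let `D̂(i,i) = (Ĉ·A·Ĉᴴ)(i,i)`.  Then the Vecchia
approximation `Â = Ĉ⁻¹·D̂·Ĉ⁻ᴴ` satisfies `det(Â) ≥ det(A)`; equivalently
`∏ᵢ D̂(i,i) ≥ det(A)`. -/
theorem vecchia_det_ge_det
    (n : ℕ) (A : Matrix (Fin n) (Fin n) ℂ) (hA : A.PosDef)
    (S : Fin n → Finset (Fin n)) (hS : ∀ i : Fin n, ∀ j ∈ S i, j < i)
    (Chat : Matrix (Fin n) (Fin n) ℂ) (hChat : UnitLowerTri Chat)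
    (hsparse : ∀ i j : Fin n, i ≠ j → j ∉ S i → Chat i j = 0)
    (hann : ∀ i : Fin n, ∀ j ∈ S i, (Chat * A) i j = 0)
    (Dhat : Matrix (Fin n) (Fin n) ℂ)
    (hDhat : Dhat = Matrix.diagonal (fun i => (Chat * A * Chatᴴ) i i)) :
    (A.det).re ≤ ((Chat⁻¹ * Dhat * (Chat⁻¹)ᴴ).det).re ∧
    (A.det).re ≤ (∏ i : Fin n, (Chat * A * Chatᴴ) i i).re := by
  have hdet : Chat.det = 1 := by
    rw [Matrix.det_of_lowerTriangular Chat (fun i j h => hChat.2 i j h)]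
    exact Finset.prod_eq_one fun i _ => hChat.1 i
  have hu : IsUnit Chat := by
    rw [Matrix.isUnit_iff_isUnit_det, hdet]; exact isUnit_one
  have hB : (Chat * A * Chatᴴ).PosDef := (Matrix.IsUnit.posDef_star_right_conjugate_iff hu).2 hA
  have h := hadamard_posDef _ hB
  have h2 : (Chat * A * Chatᴴ).det = A.det := by
    rw [Matrix.det_mul, Matrix.det_mul, Matrix.det_conjTranspose, hdet]; simp
  rw [h2] at h
  refine ⟨?_, h⟩
  have h3 : (Chat⁻¹ * Dhat * (Chat⁻¹)ᴴ).det = ∏ i : Fin n, (Chat * A * Chatᴴ) i i := by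
    rw [Matrix.det_mul, Matrix.det_mul, Matrix.det_conjTranspose, Matrix.det_nonsing_inv, hdet,
      hDhat, Matrix.det_diagonal]
    simp
  rw [h3]; exact h
end

section
/- Let A ∈ ℂ^{n×n} be Hermitian positive-definite. Then det(A) = ∏_{i=1}^{n} q_i, where q_i = inf { (e_i+v)*·A·(e_i+v) : v ∈ ℂⁿ with v(j) = 0 for all j ≥ i } is the squared A-weighted distance from the standard basis vector e_i to the span of {e_j : j < i}; each q_i is a strictly positive real number and the infimum is attained. -/
open Matrix
open scoped ComplexOrder

/-- The set of values `(e_i+v)* A (e_i+v)` (real part) over vectors `v`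
supported on `{j : j < i}`, whose infimum is the squared `A`-weighted
distance from the standard basis vector `e_i` to `span{e_j : j < i}`. -/
def distSet {n : ℕ} (A : Matrix (Fin n) (Fin n) ℂ) (i : Fin n) : Set ℝ :=
  {x : ℝ | ∃ v : Fin n → ℂ, (∀ j : Fin n, i ≤ j → v j = 0) ∧
    x = (star (Pi.single i 1 + v) ⬝ᵥ A *ᵥ (Pi.single i 1 + v)).re}

theorem exists_minimizer {n : ℕ} (A : Matrix (Fin n) (Fin n) ℂ) (hA : A.PosDef) (i : Fin n) :
    ∃ v : Fin n → ℂ, (∀ j : Fin n, i ≤ j → v j = 0) ∧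
      ∀ k, k < i → (A *ᵥ (Pi.single i 1 + v)) k = 0 := by
  have hB : (A.submatrix (Subtype.val : {j // j < i} → Fin n) Subtype.val).PosDef :=
    hA.submatrix Subtype.val_injective
  have hu := (Matrix.isUnit_iff_isUnit_det _).1 hB.isUnit
  set B := A.submatrix (Subtype.val : {j // j < i} → Fin n) Subtype.val with hBdef
  let b : {j // j < i} → ℂ := fun k => - A k i
  let x := B⁻¹ *ᵥ b
  have hx : B *ᵥ x = b := by
    simp only [x]
    rw [Matrix.mulVec_mulVec, Matrix.mul_nonsing_inv _ hu, Matrix.one_mulVec]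
  refine ⟨fun j => if h : j < i then x ⟨j, h⟩ else 0, ?_, ?_⟩
  · intro j hj
    simp [not_lt.2 hj]
  · intro k hk
    have h1 := congrFun hx ⟨k, hk⟩
    rw [Matrix.mulVec_add, Pi.add_apply]
    have h2 : (A *ᵥ (fun j => if h : j < i then x ⟨j, h⟩ else 0)) k = (B *ᵥ x) ⟨k, hk⟩ := by
      simp only [Matrix.mulVec, dotProduct, hBdef, Matrix.submatrix_apply]
      rw [← Finset.sum_filter_add_sum_filter_not Finset.univ (· < i)]
      rw [Finset.sum_eq_zero (s := Finset.univ.filter (fun j => ¬ j < i)), add_zero,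
        Finset.sum_subtype (p := (· < i)) _ (by simp)]
      · exact Finset.sum_congr rfl fun j _ => by simp [j.2]
      · intro j hj
        simp [(Finset.mem_filter.1 hj).2]
    rw [h2, h1]
    simp [b]

theorem form_split {n : ℕ} (A : Matrix (Fin n) (Fin n) ℂ) (hA : A.PosDef) (w d : Fin n → ℂ)
    (h : star d ⬝ᵥ A *ᵥ w = 0) :
    star (w + d) ⬝ᵥ A *ᵥ (w + d) = star w ⬝ᵥ A *ᵥ w + star d ⬝ᵥ A *ᵥ d := by
  have h' : star w ⬝ᵥ A *ᵥ d = 0 := by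
    have h1 := congrArg star h
    rw [← Matrix.star_dotProduct_star, star_star, Matrix.star_mulVec, hA.isHermitian.eq,
      star_zero] at h1
    rw [Matrix.dotProduct_mulVec, dotProduct_comm]
    first | exact h1 | (rw [dotProduct_comm]; exact h1)
  rw [star_add, Matrix.mulVec_add, add_dotProduct, dotProduct_add, dotProduct_add, h, h']
  ring

/-- **Determinant as a product of squared A-weighted distances.**
For a Hermitian positive-definite `A`, `det(A) = ∏ᵢ qᵢ`, where
`qᵢ = inf { (e_i+v)* A (e_i+v) : v(j) = 0 for all j ≥ i }` is the squared
`A`-weighted distance from `e_i` to `span{e_j : j < i}`; each `qᵢ` is a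
strictly positive real and the infimum is attained. -/
theorem det_eq_prod_sqDist
    (n : ℕ) (A : Matrix (Fin n) (Fin n) ℂ) (hA : A.PosDef) :
    (A.det).re = ∏ i : Fin n, sInf (distSet A i) ∧
    ∀ i : Fin n, 0 < sInf (distSet A i) ∧
      IsLeast (distSet A i) (sInf (distSet A i)) := by
  choose v hv0 hv using exists_minimizer A hA
  let w : Fin n → Fin n → ℂ := fun i => Pi.single i 1 + v i
  have hwi : ∀ i, w i i = 1 := fun i => by simp [w, hv0 i i le_rfl]
  have hwk : ∀ i k, i < k → w i k = 0 := fun i k h => by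
    simp [w, hv0 i k h.le, h.ne']
  have hq : ∀ i, star (w i) ⬝ᵥ A *ᵥ (w i) = (A *ᵥ w i) i := by
    intro i
    rw [dotProduct, Finset.sum_eq_single i]
    · simp [hwi]
    · intro k _ hk
      rcases lt_or_gt_of_ne hk with h | h
      · rw [show (A *ᵥ w i) k = 0 from hv i k h, mul_zero]
      · simp [hwk i k h]
    · simp
  have hpos : ∀ i, 0 < star (w i) ⬝ᵥ A *ᵥ (w i) := fun i =>
    hA.dotProduct_mulVec_pos (fun h => by simpa [h] using hwi i)
  have hleast : ∀ i, IsLeast (distSet A i) (star (w i) ⬝ᵥ A *ᵥ (w i)).re := by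
    intro i
    refine ⟨⟨v i, hv0 i, rfl⟩, ?_⟩
    rintro _ ⟨u, hu, rfl⟩
    have e : Pi.single i 1 + u = w i + (u - v i) := by simp [w]
    rw [e, form_split A hA (w i) (u - v i)]
    · have := (Complex.le_def.1 (hA.posSemidef.dotProduct_mulVec_nonneg (u - v i))).1
      simp only [Complex.add_re]
      simp only [Complex.zero_re] at this
      linarith
    · rw [dotProduct]
      refine Finset.sum_eq_zero fun k _ => ?_
      rcases lt_or_ge k i with h | h
      · rw [show (A *ᵥ w i) k = 0 from hv i k h, mul_zero]
      · simp [hu k h, hv0 i k h]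
  have hs : ∀ i, sInf (distSet A i) = (star (w i) ⬝ᵥ A *ᵥ (w i)).re :=
    fun i => (hleast i).csInf_eq
  refine ⟨?_, fun i => ?_⟩
  · let U : Matrix (Fin n) (Fin n) ℂ := Matrix.of fun k i => w i k
    have hU : U.det = 1 := by
      rw [Matrix.det_of_upperTriangular (M := U) (fun a b h => hwk b a h)]
      exact Finset.prod_eq_one fun i _ => hwi i
    have hAU : (A * U).det = ∏ i, (A *ᵥ w i) i := by
      rw [Matrix.det_of_lowerTriangular (A * U) (fun a b h => hv b a h)]
      rfl
    rw [Matrix.det_mul, hU, mul_one] at hAU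
    have : A.det = ((∏ i : Fin n, sInf (distSet A i) : ℝ) : ℂ) := by
      rw [hAU, Complex.ofReal_prod]
      refine Finset.prod_congr rfl fun i _ => ?_
      rw [hs, ← hq]
      have := (Complex.lt_def.1 (hpos i)).2
      exact Complex.ext rfl (by simpa using this.symm)
    rw [this, Complex.ofReal_re]
  · rw [hs]
    exact ⟨(Complex.lt_def.1 (hpos i)).1, hleast i⟩
end
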